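/- Let n>=2, let K=K(c) be an A_n-crystal, let 0<=a<=c, and let D=(D_1,...,D_{n-1}) be a deviation in Pi^up[a] (i.e. h^up+D is the coordinate of a principal vertex of K^up[a]); set D_0:=D_n:=0. Let Ktil be the middle subcrystal of K containing v^up[a|D], let K^low[b] with 0<=b<=c be the lower subcrystal of K containing Ktil, and let N=(N_2,...,N_n) be the deviation such that v^low[b|N] is the unique vertex of Ktil lying in Pi^low[b]. Then b_i=a_i+D_i^+ +D_{i-1}^- for i=1,...,n, and N_i=-D_{i-1} for i=2,...,n. -/

import Mathlib

open Classical

noncomputable section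

/-- Iterate a partial operator `k` times. -/
def optIter {V : Type} (f : V → Option V) : ℕ → V → Option V
  | 0, v => some v
  | k + 1, v => (f v).bind (optIter f k)

/-- A vertex type together with, for every natural number (color) `i`,
a partial operator whose graph is the set of `i`-edges. -/
structure PreGraph where
  V : Type
  F : ℕ → V → Option V

namespace PreGraph

/-- Partial inverse operator of color `i`. -/
def Finv (K : PreGraph) (i : ℕ) (v : K.V) : Option K.V :=
  if h : ∃ u, K.F i u = some v then some h.choose else none

/-- Number of edges of the maximal `i`-colored path beginning at `v`. -/
def h (K : PreGraph) (i : ℕ) (v : K.V) : ℕ :=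
  sSup {k | (optIter (K.F i) k v).isSome = true}

/-- Number of edges of the maximal `i`-colored path ending at `v`. -/
def t (K : PreGraph) (i : ℕ) (v : K.V) : ℕ :=
  sSup {k | ∃ u, optIter (K.F i) k u = some v}

/-- One (undirected) step along an edge of any color. -/
def Step (K : PreGraph) (u v : K.V) : Prop :=
  ∃ i, K.F i u = some v ∨ K.F i v = some u

/-- Weak connectivity. -/
def Connected (K : PreGraph) : Prop :=
  ∀ u v : K.V, Relation.ReflTransGen K.Step u v

/-- All edges have colors in `C`. -/
def ColorsIn (K : PreGraph) (C : Set ℕ) : Prop :=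
  ∀ i ∉ C, ∀ v, K.F i v = none

end PreGraph

/-- `s` has no incoming edges. -/
def IsSource (K : PreGraph) (s : K.V) : Prop := ∀ i u, K.F i u ≠ some s

/-- `tv` has no outgoing edges. -/
def IsSink (K : PreGraph) (tv : K.V) : Prop := ∀ i, K.F i tv = none

/-- `K` is a (finite) colored graph with colors in `C` satisfying axiom (A1):
every connected monochromatic subgraph is a finite directed path. -/
def IsColored (K : PreGraph) (C : Set ℕ) : Prop :=
  Finite K.V ∧ K.ColorsIn C ∧
  (∀ (i : ℕ) (u u' v : K.V), K.F i u = some v → K.F i u' = some v → u = u') ∧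
  (∀ (i : ℕ) (v : K.V) (k : ℕ), 0 < k → optIter (K.F i) k v ≠ some v)

/-- `|i - j| = 1`. -/
def Neighb (i j : ℕ) : Prop := i + 1 = j ∨ j + 1 = i

/-- `|i - j| ≥ 2`. -/
def Far (i j : ℕ) : Prop := i + 2 ≤ j ∨ j + 2 ≤ i

instance (i j : ℕ) : Decidable (Neighb i j) := by unfold Neighb; infer_instance
instance (i j : ℕ) : Decidable (Far i j) := by unfold Far; infer_instance

/-- Axiom (A2) for the ordered pair of distinct colors `(i, j)`. -/
def A2at (K : PreGraph) (i j : ℕ) : Prop :=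
  (∀ u v, K.F i u = some v →
    K.t j v ≤ K.t j u ∧ K.h j u ≤ K.h j v ∧
    ((K.h j u : ℤ) - (K.t j u : ℤ)) - ((K.h j v : ℤ) - (K.t j v : ℤ)) =
      (if Neighb i j then (-1 : ℤ) else 0)) ∧
  (∀ u v w, K.F i u = some v → K.F i v = some w →
    2 * K.h j v ≤ K.h j u + K.h j w)

/-- Axiom (A3) for neighboring colors `i, j`. -/
def A3at (K : PreGraph) (i j : ℕ) : Prop :=
  (∀ u v v', K.F i u = some v → K.F j u = some v' →
    K.h j v = K.h j u →
    ((K.h i v' : ℤ) - (K.h i u : ℤ) = 1 ∧ ∃ w, K.F j v = some w ∧ K.F i v' = some w)) ∧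
  (∀ u u' v, K.F i u = some v → K.F j u' = some v →
    (K.h j v : ℤ) - (K.h j u : ℤ) = 1 →
    (K.h i v = K.h i u' ∧ ∃ w, K.F j w = some u ∧ K.F i w = some u'))

/-- Axiom (A4) (Verma relations) for neighboring colors `i, j`. -/
def A4at (K : PreGraph) (i j : ℕ) : Prop :=
  (∀ u v v', K.F i u = some v → K.F j u = some v' →
    (K.h j v : ℤ) - (K.h j u : ℤ) = 1 → (K.h i v' : ℤ) - (K.h i u : ℤ) = 1 →
    ∃ w, (((K.F i u).bind (K.F j)).bind (K.F j)).bind (K.F i) = some w ∧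
         (((K.F j u).bind (K.F i)).bind (K.F i)).bind (K.F j) = some w) ∧
  (∀ u u' v, K.F i u = some v → K.F j u' = some v →
    K.h j v = K.h j u → K.h i v = K.h i u' →
    ∃ w, (((K.Finv i v).bind (K.Finv j)).bind (K.Finv j)).bind (K.Finv i) = some w ∧
         (((K.Finv j v).bind (K.Finv i)).bind (K.Finv i)).bind (K.Finv j) = some w)

/-- Axiom (A5) for colors `i, j` at distance at least 2. -/
def A5at (K : PreGraph) (i j : ℕ) : Prop :=
  ∀ Fi ∈ ({K.F i, K.Finv i} : Set (K.V → Option K.V)),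
  ∀ Fj ∈ ({K.F j, K.Finv j} : Set (K.V → Option K.V)),
  ∀ v, (Fi v).isSome → (Fj v).isSome →
    ∃ w, (Fi v).bind Fj = some w ∧ (Fj v).bind Fi = some w

/-- `K` is a regular crystal of type A on the color set `C`
(an `A_{|C|}`-crystal when `C` is an integer interval). -/
def IsCrystalOn (K : PreGraph) (C : Set ℕ) : Prop :=
  IsColored K C ∧ K.Connected ∧
  (∀ i ∈ C, ∀ j ∈ C, i ≠ j → A2at K i j) ∧
  (∀ i ∈ C, ∀ j ∈ C, Neighb i j → A3at K i j ∧ A4at K i j) ∧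
  (∀ i ∈ C, ∀ j ∈ C, Far i j → A5at K i j)

/-- `K` is an `A_n`-crystal (colors `1, …, n`). -/
def IsACrystal (n : ℕ) (K : PreGraph) : Prop := IsCrystalOn K (Set.Icc 1 n)

/-- Apply a list of operators, head first. -/
def applyStr (K : PreGraph) : List ℕ → K.V → Option K.V
  | [], v => some v
  | i :: L, v => (K.F i v).bind (applyStr K L)

/-- The string `w_{m,k,j} = F_{o+j} F_{o+j+1} ⋯ F_{o+j+k-1}` (rightmost applied
first, i.e. head of the list applied first) for a crystal with colors `o+1, …, o+m`. -/
def wStr (o k j : ℕ) : List ℕ := (List.range k).map (fun m => o + j + k - 1 - m)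

/-- The string `S_{m,k} = w_{m,k,m-k+1} ⋯ w_{m,k,2} w_{m,k,1}` for a crystal with
colors `o+1, …, o+m`. -/
def SStr (o m k : ℕ) : List ℕ :=
  (List.range (m - k + 1)).flatMap fun jm => wStr o k (jm + 1)

/-- The string `S_{m,m}^{a_{o+m}} ⋯ S_{m,1}^{a_{o+1}}` for a crystal with colors
`o+1, …, o+m`, defining the principal vertex with coordinates `a`. -/
def prinStr (o m : ℕ) (a : ℕ → ℕ) : List ℕ :=
  (List.range m).flatMap fun km => (List.replicate (a (o + km + 1)) (SStr o m (km + 1))).flatten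

def prinOpt (K : PreGraph) (o m : ℕ) (s : K.V) (a : ℕ → ℕ) : Option K.V :=
  applyStr K (prinStr o m a) s

/-- `p` is the principal vertex with coordinates `a` of the crystal `K` with colors
`o+1, …, o+m` and source `s`. -/
def IsPrin (K : PreGraph) (o m : ℕ) (s : K.V) (a : ℕ → ℕ) (p : K.V) : Prop :=
  prinOpt K o m s a = some p

/-- The principal lattice of an `A_n`-crystal with source `s` and parameter `c`. -/
def PrinLat (K : PreGraph) (n : ℕ) (s : K.V) (c : ℕ → ℕ) : Set K.V :=
  {p | ∃ a : ℕ → ℕ, (∀ i, 1 ≤ i → i ≤ n → a i ≤ c i) ∧ IsPrin K 0 n s a p}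

/-- One undirected step along an edge with color in `I`. -/
def stepOn (K : PreGraph) (I : Set ℕ) (u v : K.V) : Prop :=
  ∃ i ∈ I, K.F i u = some v ∨ K.F i v = some u

/-- `u` lies in the same `I`-colored component as `v`. -/
def inComp (K : PreGraph) (I : Set ℕ) (v u : K.V) : Prop :=
  Relation.ReflTransGen (stepOn K I) v u

/-- The subcrystal of `K` with color set `I` containing `v` (the maximal connected
subgraph through `v` using only colors in `I`). -/
def PreGraph.sub (K : PreGraph) (I : Set ℕ) (v : K.V) : PreGraph where
  V := {u : K.V // inComp K I v u}
  F := fun i u =>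
    if hi : i ∈ I then
      (K.F i u.1).pbind fun w hw =>
        some ⟨w, Relation.ReflTransGen.tail u.2 ⟨i, hi, Or.inl (Option.mem_def.mp hw)⟩⟩
    else none

/-- Directed reachability. -/
def dirReach (K : PreGraph) (u v : K.V) : Prop :=
  Relation.ReflTransGen (fun a b => ∃ i, K.F i a = some b) u v

/-- The interval of `K` from `p` to `q`: the subgraph formed by all vertices and
edges lying on directed paths from `p` to `q`. -/
def PreGraph.interval (K : PreGraph) (p q : K.V) : PreGraph where
  V := {w : K.V // dirReach K p w ∧ dirReach K w q}
  F := fun i u =>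
    (K.F i u.1).pbind fun w _ =>
      if hw : dirReach K p w ∧ dirReach K w q then some ⟨w, hw⟩ else none

/-- The symmetric extract: restriction to self-complementary vertices,
with `ibar`-edges given by `chain i`. -/
def extract (K : PreGraph) (chain : ℕ → K.V → Option K.V) (σ : K.V → K.V) : PreGraph where
  V := {v : K.V // σ v = v}
  F := fun i u =>
    (chain i u.1).pbind fun w _ => if hw : σ w = w then some ⟨w, hw⟩ else none

/-- The operator chain for the color `ibar` of the symmetric extract of a
symmetric `A_{2n-1}`-crystal. -/
def chainB (K : PreGraph) (n : ℕ) (i : ℕ) (u : K.V) : Option K.V :=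
  if 1 ≤ i ∧ i ≤ n then
    (if i = n then K.F n u else (K.F i u).bind (K.F (2 * n - i)))
  else none

/-- The operator chain for the color `ibar` of the symmetric extract of a
symmetric `A_{2n}`-crystal. -/
def chainC (K : PreGraph) (n : ℕ) (i : ℕ) (u : K.V) : Option K.V :=
  if 1 ≤ i ∧ i ≤ n then
    (if i = n then (((K.F n u).bind (K.F (n + 1))).bind (K.F (n + 1))).bind (K.F n)
     else (K.F i u).bind (K.F (2 * n + 1 - i)))
  else none

/-- Symmetric extract from a symmetric `A_{2n-1}`-crystal. -/
def extractB (K : PreGraph) (n : ℕ) (σ : K.V → K.V) : PreGraph := extract K (chainB K n) σ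

/-- Symmetric extract from a symmetric `A_{2n}`-crystal. -/
def extractC (K : PreGraph) (n : ℕ) (σ : K.V → K.V) : PreGraph := extract K (chainC K n) σ

/-- Admissibility of a six-tuple `(x', y, x''; y', x, y'')` in the worm model. -/
def WormOK (g1 g2 : ℕ) : ℤ × ℤ × ℤ × ℤ × ℤ × ℤ → Prop
  | (x', y, x'', y', x, y'') =>
    (0 ≤ x' ∧ x' ≤ 2 * (g1 : ℤ)) ∧ (0 ≤ x'' ∧ x'' ≤ 2 * (g1 : ℤ)) ∧
    (0 ≤ x ∧ x ≤ 2 * (g1 : ℤ)) ∧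
    (0 ≤ y' ∧ y' ≤ (g2 : ℤ)) ∧ (0 ≤ y'' ∧ y'' ≤ (g2 : ℤ)) ∧ (0 ≤ y ∧ y ≤ (g2 : ℤ)) ∧
    (2 ∣ x') ∧ (2 ∣ x'') ∧ (y' ≤ y ∧ y ≤ y'') ∧ (x' ≤ x ∧ x ≤ x'') ∧
    (y' < y → x' = x) ∧ (y < y'' → x = x'')

/-- The candidate image of a worm under the operator `1tilde`. -/
def worm1 : ℤ × ℤ × ℤ × ℤ × ℤ × ℤ → ℤ × ℤ × ℤ × ℤ × ℤ × ℤ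
  | (x', y, x'', y', x, y'') =>
    if 2 * x > x' + x'' then (x' + 2, y, x'', y', x, y'')
    else if x = x' ∧ x' = x'' ∧ y < y'' then (x', y + 1, x'', y', x, y'')
    else (x', y, x'' + 2, y', x, y'')

/-- The candidate image of a worm under the operator `2tilde`. -/
def worm2 : ℤ × ℤ × ℤ × ℤ × ℤ × ℤ → ℤ × ℤ × ℤ × ℤ × ℤ × ℤ
  | (x', y, x'', y', x, y'') =>
    if 2 * y > y' + y'' then (x', y, x'', y' + 1, x, y'')
    else if y' = y ∧ y = y'' ∧ x < x'' then (x', y, x'', y', x + 1, y'')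
    else (x', y, x'', y', x, y'' + 1)

/-- The worm graph `W(g1, g2)`, with colors `1 = 1tilde` and `2 = 2tilde`. -/
def WormGraph (g1 g2 : ℕ) : PreGraph where
  V := {w : ℤ × ℤ × ℤ × ℤ × ℤ × ℤ // WormOK g1 g2 w}
  F := fun i u =>
    if i = 1 then
      (if h1 : WormOK g1 g2 (worm1 u.1) then some ⟨worm1 u.1, h1⟩ else none)
    else if i = 2 then
      (if h2 : WormOK g1 g2 (worm2 u.1) then some ⟨worm2 u.1, h2⟩ else none)
    else none

/-- Isomorphism of colored graphs, renaming colors via `φ`. -/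
def IsoVia (K L : PreGraph) (φ : ℕ → ℕ) : Prop :=
  ∃ e : K.V ≃ L.V, ∀ i u v, K.F i u = some v ↔ L.F (φ i) (e u) = some (e v)

/-- The Cartesian product of an `i`-path of length `p` and a `j`-path of length `q`. -/
def boxGraph (i j p q : ℕ) : PreGraph where
  V := Fin (p + 1) × Fin (q + 1)
  F := fun s u =>
    if s = i then
      (if h : (u.1 : ℕ) < p then some (⟨(u.1 : ℕ) + 1, by omega⟩, u.2) else none)
    else if s = j then
      (if h : (u.2 : ℕ) < q then some (u.1, ⟨(u.2 : ℕ) + 1, by omega⟩) else none)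
    else none

/-- `B_n`-crystal: components with colors `n-1, n` are worm graphs,
with color `n-1` corresponding to `1tilde` and `n` to `2tilde`. -/
def IsBCrystal (n : ℕ) (B : PreGraph) : Prop :=
  IsColored B (Set.Icc 1 n) ∧ B.Connected ∧
  (∀ i ∈ Set.Icc 1 n, ∀ j ∈ Set.Icc 1 n, Far i j → A5at B i j) ∧
  (∀ i j, 1 ≤ i → i < n → 1 ≤ j → j < n → Neighb i j →
    ∀ v : B.V, IsCrystalOn (B.sub {i, j} v) {i, j}) ∧
  (∀ v : B.V, ∃ g1 g2 : ℕ,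
    IsoVia (B.sub ({n - 1, n} : Set ℕ) v) (WormGraph g1 g2)
      (fun x => if x = n - 1 then 1 else if x = n then 2 else 0))

/-- `C_n`-crystal: components with colors `n-1, n` are worm graphs,
with color `n-1` corresponding to `2tilde` and `n` to `1tilde`. -/
def IsCCrystal (n : ℕ) (B : PreGraph) : Prop :=
  IsColored B (Set.Icc 1 n) ∧ B.Connected ∧
  (∀ i ∈ Set.Icc 1 n, ∀ j ∈ Set.Icc 1 n, Far i j → A5at B i j) ∧
  (∀ i j, 1 ≤ i → i < n → 1 ≤ j → j < n → Neighb i j →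
    ∀ v : B.V, IsCrystalOn (B.sub {i, j} v) {i, j}) ∧
  (∀ v : B.V, ∃ g1 g2 : ℕ,
    IsoVia (B.sub ({n - 1, n} : Set ℕ) v) (WormGraph g1 g2)
      (fun x => if x = n - 1 then 2 else if x = n then 1 else 0))

/-! ### The crossing model -/

/-- `(k, i, j)` is a node `v_i^k(j)` of the supporting graph `G` for rank `n`. -/
def isNode (n k i j : ℕ) : Prop :=
  1 ≤ j ∧ j ≤ i ∧ i ≤ n ∧ i - j + 1 ≤ k ∧ k ≤ n - j + 1

instance (n k i j : ℕ) : Decidable (isNode n k i j) := by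
  unfold isNode; infer_instance

/-- Extension of a function on the nodes of `G` to the extended supporting graph:
extra nodes from which `G^k` is reachable get value `c k`, the others get `0`. -/
def fext (n : ℕ) (c : ℕ → ℕ) (f : ℕ × ℕ × ℕ → ℤ) (k i j : ℕ) : ℤ :=
  if isNode n k i j then f (k, i, j)
  else if j ≤ n - k + 1 then (c k : ℤ) else 0

/-- The slack at the node `v_i^k(j)`. -/
def epsN (n : ℕ) (c : ℕ → ℕ) (f : ℕ × ℕ × ℕ → ℤ) (k i j : ℕ) : ℤ :=
  (fext n c f k (i - 1) (j - 1) - fext n c f k i j) -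
    (fext n c f k i (j - 1) - fext n c f k (i + 1) j)

/-- The total slack at the multinode `V_i(j)`. -/
def epsTot (n : ℕ) (c : ℕ → ℕ) (f : ℕ × ℕ × ℕ → ℤ) (i j : ℕ) : ℤ :=
  ∑ k ∈ Finset.Icc (i - j + 1) (n - j + 1), epsN n c f k i j

/-- The reduced slack at the multinode `V_i(j)`. -/
def teps (n : ℕ) (c : ℕ → ℕ) (f : ℕ × ℕ × ℕ → ℤ) (i j : ℕ) : ℤ :=
  if hj : (Finset.Icc 1 j).Nonempty then
    max 0 ((Finset.Icc 1 j).inf' hj fun p => ∑ q ∈ Finset.Icc p j, epsTot n c f i q)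
  else 0

/-- `k0` satisfies the switch condition in the multinode `V_i(j)`. -/
def switchCond (n : ℕ) (f : ℕ × ℕ × ℕ → ℤ) (i j k0 : ℕ) : Prop :=
  i - j + 1 ≤ k0 ∧ k0 ≤ n - j + 1 ∧
  (∀ k, i - j + 1 ≤ k → k < k0 → isNode n k (i + 1) (j + 1) →
    f (k, i, j) = f (k, i + 1, j + 1)) ∧
  (∀ k, k0 < k → k ≤ n - j + 1 → isNode n k (i + 1) j →
    f (k, i + 1, j) = f (k, i, j))

/-- The switch-node (first node with the switch property) of the multinode `V_i(j)`. -/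
def switchNode (n : ℕ) (f : ℕ × ℕ × ℕ → ℤ) (i j : ℕ) : ℕ :=
  sInf {k0 | switchCond n f i j k0}

/-- Feasible functions of the crossing model (normalized to vanish off the nodes). -/
def Feasible (n : ℕ) (c : ℕ → ℕ) (f : ℕ × ℕ × ℕ → ℤ) : Prop :=
  (∀ k i j, ¬ isNode n k i j → f (k, i, j) = 0) ∧
  (∀ k i j, isNode n k i j → isNode n k (i - 1) j → f (k, i - 1, j) ≤ f (k, i, j)) ∧
  (∀ k i j, isNode n k i j → isNode n k (i + 1) (j + 1) → f (k, i + 1, j + 1) ≤ f (k, i, j)) ∧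
  (∀ k i j, isNode n k i j → 0 ≤ f (k, i, j) ∧ f (k, i, j) ≤ (c k : ℤ)) ∧
  (∀ i j, 1 ≤ j → j ≤ i → i ≤ n → ∃ k0, switchCond n f i j k0)

/-- Increase `f` by one at the node `(k, i, j)`. -/
def bump (f : ℕ × ℕ × ℕ → ℤ) (k i j : ℕ) : ℕ × ℕ × ℕ → ℤ :=
  fun x => if x = (k, i, j) then f x + 1 else f x

/-- The crossing-model graph `Kscr(c)`: vertices are the feasible functions, and
the move `φ_i` increases `f` by one at the switch-node of the active multinode. -/
def Kscr (n : ℕ) (c : ℕ → ℕ) : PreGraph where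
  V := {f : ℕ × ℕ × ℕ → ℤ // Feasible n c f}
  F := fun i f =>
    if 1 ≤ i ∧ i ≤ n ∧ ∃ j, 1 ≤ j ∧ j ≤ i ∧ 0 < teps n c f.1 i j then
      (let j := sSup {j | 1 ≤ j ∧ j ≤ i ∧ 0 < teps n c f.1 i j}
       let g := bump f.1 (switchNode n f.1 i j) i j
       if hg : Feasible n c g then some ⟨g, hg⟩ else none)
    else none

/-- The function `f_{a,D}` of the crossing model. -/
def faD (n : ℕ) (a : ℕ → ℕ) (D : ℕ → ℤ) : ℕ × ℕ × ℕ → ℤ := fun x =>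
  if isNode n x.1 x.2.1 x.2.2 then
    (if x.2.1 - x.2.2 + 1 = x.1 then (a x.1 : ℤ) else (a x.1 : ℤ) + min (D (x.1 - 1)) 0) +
    (if x.2.2 ≤ n - x.1 then max (D x.1) 0 else 0)
  else 0

/-! ### Descriptions of self-complementary vertices -/

/-- `(a1, a2, δ, l)` is the description of a self-complementary vertex `v` of a
symmetric `A_3`-crystal `K` with source `s` and parameter `c`. -/
def IsDescB (K : PreGraph) (s : K.V) (c : ℕ → ℕ) (v : K.V) (q : ℕ × ℕ × ℤ × ℕ) : Prop :=
  q.2.2.2 = K.t 2 v ∧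
  ∃ (a : ℕ → ℕ) (pa : K.V),
    a 1 = q.1 ∧ a 2 = q.2.1 ∧ a 3 = ((q.1 : ℤ) + max q.2.2.1 0).toNat ∧
    (∀ i, 1 ≤ i → i ≤ 3 → a i ≤ c i) ∧
    IsPrin K 0 3 s a pa ∧ inComp K (Set.Icc 1 2) pa v ∧
    0 ≤ (q.2.1 : ℤ) + q.2.2.1 ∧ 0 ≤ (a 3 : ℤ) - q.2.2.1 ∧
    ∃ s' : (K.sub (Set.Icc 1 2) pa).V, IsSource (K.sub (Set.Icc 1 2) pa) s' ∧
    ∃ z : (K.sub (Set.Icc 1 2) pa).V,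
      IsPrin (K.sub (Set.Icc 1 2) pa) 0 2 s'
        (fun i => if i = 1 then ((q.2.1 : ℤ) + q.2.2.1).toNat else ((a 3 : ℤ) - q.2.2.1).toNat) z ∧
      inComp K ({2} : Set ℕ) z.1 v

/-- The polytope of descriptions for a symmetric `A_3`-crystal with parameter `(c1, c2, c1)`. -/
def QuadB (c1 c2 : ℕ) : Set (ℕ × ℕ × ℤ × ℕ) :=
  {q | q.1 ≤ c1 ∧ q.2.1 ≤ c2 ∧ -(q.2.1 : ℤ) ≤ q.2.2.1 ∧ (q.2.1 : ℤ) - (c2 : ℤ) ≤ q.2.2.1 ∧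
       q.2.2.1 ≤ (c1 : ℤ) - (q.1 : ℤ) ∧ (q.2.2.2 : ℤ) ≤ (c2 : ℤ) + 2 * q.2.2.1}

/-- The worm associated to the description `(a1, a2, δ, l)`. -/
def wtupleB (a1 a2 : ℕ) (δ : ℤ) (l : ℕ) : ℤ × ℤ × ℤ × ℤ × ℤ × ℤ :=
  let a3 : ℤ := (a1 : ℤ) + max δ 0
  let tr : ℤ × ℤ × ℤ :=
    if 0 ≤ δ then
      if (l : ℤ) ≤ (a2 : ℤ) then ((l : ℤ), 2 * (a1 : ℤ), (a2 : ℤ))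
      else if (l : ℤ) ≤ (a2 : ℤ) + 2 * δ then
        ((a2 : ℤ), 2 * (a1 : ℤ) + (l : ℤ) - (a2 : ℤ), (a2 : ℤ))
      else ((a2 : ℤ), 2 * a3, (l : ℤ) - 2 * δ)
    else
      if (l : ℤ) ≤ (a2 : ℤ) + δ then ((l : ℤ), 2 * (a1 : ℤ), (a2 : ℤ) - δ)
      else ((a2 : ℤ) + δ, 2 * (a1 : ℤ), (l : ℤ) - 2 * δ)
  (2 * (a1 : ℤ), (a2 : ℤ), 2 * a3, tr.1, tr.2.1, tr.2.2)

def wtQ (q : ℕ × ℕ × ℤ × ℕ) : ℤ × ℤ × ℤ × ℤ × ℤ × ℤ :=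
  wtupleB q.1 q.2.1 q.2.2.1 q.2.2.2

/-- The string `(F_2 F_3)^r (F_3 F_2)^r` (rightmost applied first). -/
def diagStr (r : ℕ) : List ℕ :=
  (List.replicate r ([2, 3] : List ℕ)).flatten ++ (List.replicate r ([3, 2] : List ℕ)).flatten

/-- `(a1, a2, δ, ρ)` is the description of a self-complementary vertex `v` of a
symmetric `A_4`-crystal `K` with source `s` and parameter `c`. -/
def IsDescC (K : PreGraph) (s : K.V) (c : ℕ → ℕ) (v : K.V) (q : ℕ × ℕ × ℤ × ℕ) : Prop :=
  ∃ (a : ℕ → ℕ) (pa : K.V),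
    a 1 = q.1 ∧ a 2 = q.2.1 ∧ a 3 = ((q.2.1 : ℤ) + min q.2.2.1 0).toNat ∧
    a 4 = ((q.1 : ℤ) + max q.2.2.1 0).toNat ∧
    (∀ i, 1 ≤ i → i ≤ 4 → a i ≤ c i) ∧
    IsPrin K 0 4 s a pa ∧ inComp K (Set.Icc 1 3) pa v ∧
    0 ≤ (q.2.1 : ℤ) + q.2.2.1 ∧ 0 ≤ (a 4 : ℤ) - q.2.2.1 ∧
    (∃ s' : (K.sub (Set.Icc 1 3) pa).V, IsSource (K.sub (Set.Icc 1 3) pa) s' ∧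
     ∃ z : (K.sub (Set.Icc 1 3) pa).V,
       IsPrin (K.sub (Set.Icc 1 3) pa) 0 3 s'
         (fun i => if i = 1 then ((q.2.1 : ℤ) + q.2.2.1).toNat
                   else if i = 2 then a 3 else ((a 4 : ℤ) - q.2.2.1).toNat) z ∧
       inComp K (Set.Icc 2 3) z.1 v) ∧
    (∃ stil : (K.sub (Set.Icc 2 3) v).V, IsSource (K.sub (Set.Icc 2 3) v) stil ∧
       applyStr (K.sub (Set.Icc 2 3) v) (diagStr q.2.2.2) stil =
         some ⟨v, Relation.ReflTransGen.refl⟩)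

/-- The polytope of descriptions for a symmetric `A_4`-crystal with parameter
`(c1, c2, c2, c1)`. -/
def QuadC (c1 c2 : ℕ) : Set (ℕ × ℕ × ℤ × ℕ) :=
  {q | q.1 ≤ c1 ∧ q.2.1 ≤ c2 ∧ -(q.2.1 : ℤ) ≤ q.2.2.1 ∧
       q.2.2.1 ≤ (c1 : ℤ) - (q.1 : ℤ) ∧ (q.2.2.2 : ℤ) ≤ (c2 : ℤ) + q.2.2.1}

end


/-! ### Strings of operators -/

theorem applyStr_append {K : PreGraph} (L M : List ℕ) (u : K.V) :
    applyStr K (L ++ M) u = (applyStr K L u).bind (applyStr K M) := by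
  induction L generalizing u with
  | nil => simp [applyStr]
  | cons i L ih =>
    simp only [List.cons_append, applyStr, Option.bind_assoc]
    congr 1
    funext w
    exact ih w

theorem applyStr_append_eq_some {K : PreGraph} {L M : List ℕ} {u v : K.V} :
    applyStr K (L ++ M) u = some v ↔
      ∃ w, applyStr K L u = some w ∧ applyStr K M w = some v := by
  rw [applyStr_append, Option.bind_eq_some_iff]

theorem applyStr_singleton {K : PreGraph} (i : ℕ) (u : K.V) :
    applyStr K [i] u = K.F i u := by
  simp [applyStr]

theorem applyStr_congr_left {K : PreGraph} {L L' : List ℕ} {u : K.V} (M : List ℕ)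
    (h : applyStr K L u = applyStr K L' u) :
    applyStr K (L ++ M) u = applyStr K (L' ++ M) u := by
  rw [applyStr_append, applyStr_append, h]

theorem applyStr_congr_right {K : PreGraph} {M M' : List ℕ} {u : K.V} (L : List ℕ)
    (h : ∀ w, applyStr K L u = some w → applyStr K M w = applyStr K M' w) :
    applyStr K (L ++ M) u = applyStr K (L ++ M') u := by
  rw [applyStr_append, applyStr_append]
  cases hw : applyStr K L u with
  | none => rfl
  | some w => simpa using h w hw

theorem optIter_eq_applyStr {K : PreGraph} (i k : ℕ) (u : K.V) :
    optIter (K.F i) k u = applyStr K (List.replicate k i) u := by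
  induction k generalizing u with
  | zero => rfl
  | succ k ih =>
    simp only [optIter, List.replicate_succ, applyStr]
    congr 1
    funext w
    exact ih w

/-! ### Lengths of monochromatic paths -/

theorem applyStr_replicate_ne_self {K : PreGraph} {C : Set ℕ} (hK : IsColored K C) {i k : ℕ}
    {u v : K.V} (hk : 0 < k) (h : applyStr K (List.replicate k i) u = some v) : u ≠ v := by
  rintro rfl
  exact hK.2.2.2 i u k hk (by rw [optIter_eq_applyStr, h])

theorem applyStr_replicate_inj {K : PreGraph} {C : Set ℕ} (hK : IsColored K C) {i k : ℕ}
    {u u' v : K.V} (h : applyStr K (List.replicate k i) u = some v)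
    (h' : applyStr K (List.replicate k i) u' = some v) : u = u' := by
  induction k generalizing v with
  | zero => simp_all [applyStr]
  | succ k ih =>
    rw [List.replicate_succ', applyStr_append_eq_some] at h h'
    obtain ⟨w, hw, hwv⟩ := h
    obtain ⟨w', hw', hwv'⟩ := h'
    rw [applyStr_singleton] at hwv hwv'
    obtain rfl := hK.2.2.1 i w w' v hwv hwv'
    exact ih hw hw'

theorem le_h_iff {K : PreGraph} {C : Set ℕ} (hK : IsColored K C) {i k : ℕ} {v : K.V} :
    k ≤ K.h i v ↔ ∃ w, applyStr K (List.replicate k i) v = some w := by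
  have := hK.1
  have down : ∀ a b, a ≤ b → (∃ w, applyStr K (List.replicate b i) v = some w) →
      ∃ w, applyStr K (List.replicate a i) v = some w := by
    rintro a b hab ⟨w, hw⟩
    obtain ⟨d, rfl⟩ := Nat.exists_eq_add_of_le hab
    rw [List.replicate_add, applyStr_append_eq_some] at hw
    obtain ⟨x, hx, -⟩ := hw
    exact ⟨x, hx⟩
  have hset : {k | (optIter (K.F i) k v).isSome = true} =
      {k | ∃ w, applyStr K (List.replicate k i) v = some w} := by
    ext k
    simp [optIter_eq_applyStr, Option.isSome_iff_exists]
  have bdd : BddAbove {k | ∃ w, applyStr K (List.replicate k i) v = some w} := by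
    by_contra hb
    rw [not_bddAbove_iff] at hb
    have all : ∀ k, ∃ w, applyStr K (List.replicate k i) v = some w := fun k => by
      obtain ⟨b, hb, hkb⟩ := hb k
      exact down k b hkb.le hb
    choose g hg using all
    have key : ∀ a b, a < b → g a ≠ g b := by
      intro a b hab
      obtain ⟨d, rfl⟩ := Nat.exists_eq_add_of_le hab.le
      have h2 := hg (a + d)
      rw [List.replicate_add, applyStr_append_eq_some] at h2
      obtain ⟨x, hx, hxd⟩ := h2
      rw [hg a] at hx
      cases hx
      exact applyStr_replicate_ne_self hK (by omega) hxd
    refine not_injective_infinite_finite g fun a b hab => ?_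
    rcases lt_trichotomy a b with h | h | h
    · exact absurd hab (key a b h)
    · exact h
    · exact absurd hab.symm (key b a h)
  unfold PreGraph.h
  rw [hset]
  constructor
  · intro hk
    have ne : {k | ∃ w, applyStr K (List.replicate k i) v = some w}.Nonempty := ⟨0, v, rfl⟩
    exact down k _ hk (Nat.sSup_mem ne bdd)
  · intro hk
    exact le_csSup bdd hk

theorem le_t_iff {K : PreGraph} {C : Set ℕ} (hK : IsColored K C) {i k : ℕ} {v : K.V} :
    k ≤ K.t i v ↔ ∃ u, applyStr K (List.replicate k i) u = some v := by
  have := hK.1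
  have down : ∀ a b, a ≤ b → (∃ u, applyStr K (List.replicate b i) u = some v) →
      ∃ u, applyStr K (List.replicate a i) u = some v := by
    rintro a b hab ⟨w, hw⟩
    obtain ⟨d, rfl⟩ := Nat.exists_eq_add_of_le' hab
    rw [List.replicate_add, applyStr_append_eq_some] at hw
    obtain ⟨x, -, hx⟩ := hw
    exact ⟨x, hx⟩
  have hset : {k | ∃ u, optIter (K.F i) k u = some v} =
      {k | ∃ u, applyStr K (List.replicate k i) u = some v} := by
    ext k
    simp [optIter_eq_applyStr]
  have bdd : BddAbove {k | ∃ u, applyStr K (List.replicate k i) u = some v} := by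
    by_contra hb
    rw [not_bddAbove_iff] at hb
    have all : ∀ k, ∃ w, applyStr K (List.replicate k i) w = some v := fun k => by
      obtain ⟨b, hb, hkb⟩ := hb k
      exact down k b hkb.le hb
    choose g hg using all
    have key : ∀ a b, a < b → g a ≠ g b := by
      intro a b hab he
      obtain ⟨d, rfl⟩ := Nat.exists_eq_add_of_le hab.le
      have h2 := hg (a + d)
      rw [← he, List.replicate_add, applyStr_append_eq_some] at h2
      obtain ⟨x, hx, hxd⟩ := h2
      rw [hg a] at hx
      cases hx
      exact applyStr_replicate_ne_self hK (by omega) hxd rfl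
    refine not_injective_infinite_finite g fun a b hab => ?_
    rcases lt_trichotomy a b with h | h | h
    · exact absurd hab (key a b h)
    · exact h
    · exact absurd hab.symm (key b a h)
  unfold PreGraph.t
  rw [hset]
  constructor
  · intro hk
    have ne : {k | ∃ u, applyStr K (List.replicate k i) u = some v}.Nonempty := ⟨0, v, rfl⟩
    exact down k _ hk (Nat.sSup_mem ne bdd)
  · intro hk
    exact le_csSup bdd hk

theorem h_eq_succ {K : PreGraph} {C : Set ℕ} (hK : IsColored K C) {i : ℕ} {u v : K.V}
    (huv : K.F i u = some v) : K.h i u = K.h i v + 1 := by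
  refine eq_of_forall_le_iff fun k => ?_
  cases k with
  | zero => simp
  | succ k =>
    rw [Nat.add_le_add_iff_right, le_h_iff hK, le_h_iff hK]
    simp [List.replicate_succ, applyStr, huv]

theorem t_eq_succ {K : PreGraph} {C : Set ℕ} (hK : IsColored K C) {i : ℕ} {u v : K.V}
    (huv : K.F i u = some v) : K.t i v = K.t i u + 1 := by
  refine eq_of_forall_le_iff fun k => ?_
  cases k with
  | zero => simp
  | succ k =>
    rw [Nat.add_le_add_iff_right, le_t_iff hK, le_t_iff hK]
    simp only [List.replicate_succ', applyStr_append_eq_some, applyStr_singleton]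
    constructor
    · rintro ⟨x, w, hw, hwv⟩
      obtain rfl := hK.2.2.1 i w u v hwv huv
      exact ⟨x, hw⟩
    · rintro ⟨x, hx⟩
      exact ⟨x, u, hx, huv⟩

theorem h_pos_iff {K : PreGraph} {C : Set ℕ} (hK : IsColored K C) {i : ℕ} {v : K.V} :
    0 < K.h i v ↔ ∃ w, K.F i v = some w := by
  rw [← Nat.succ_le_iff, Nat.succ_eq_add_one, zero_add, le_h_iff hK]
  simp [applyStr]

theorem t_pos_iff {K : PreGraph} {C : Set ℕ} (hK : IsColored K C) {i : ℕ} {v : K.V} :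
    0 < K.t i v ↔ ∃ u, K.F i u = some v := by
  rw [← Nat.succ_le_iff, Nat.succ_eq_add_one, zero_add, le_t_iff hK]
  simp [applyStr]

theorem Finv_eq_some_iff {K : PreGraph} {C : Set ℕ} (hK : IsColored K C) {i : ℕ} {u v : K.V} :
    K.Finv i v = some u ↔ K.F i u = some v := by
  unfold PreGraph.Finv
  constructor
  · intro h
    split_ifs at h with hex
    cases h
    exact hex.choose_spec
  · intro h
    have hex : ∃ u, K.F i u = some v := ⟨u, h⟩
    rw [dif_pos hex]
    exact congrArg some (hK.2.2.1 i _ _ v hex.choose_spec h)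

theorem color_mem {K : PreGraph} {C : Set ℕ} (hK : IsColored K C) {i : ℕ} {u v : K.V}
    (huv : K.F i u = some v) : i ∈ C := by
  by_contra hi
  simp [hK.2.1 i hi u] at huv

/-! ### Consequences of the axioms along one edge -/

theorem edge_t_le {K : PreGraph} {n : ℕ} (hK : IsACrystal n K) {i j : ℕ} (hij : i ≠ j)
    {u v : K.V} (huv : K.F i u = some v) : K.t j v ≤ K.t j u := by
  by_cases hj : j ∈ Set.Icc 1 n
  · exact ((hK.2.2.1 i (color_mem hK.1 huv) j hj hij).1 u v huv).1
  · by_contra hlt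
    obtain ⟨w, hw⟩ := (t_pos_iff hK.1 (v := v) (i := j)).1 (by omega)
    exact hj (color_mem hK.1 hw)

theorem edge_weight {K : PreGraph} {n : ℕ} (hK : IsACrystal n K) {i j : ℕ} (hij : i ≠ j)
    (hj : j ∈ Set.Icc 1 n) {u v : K.V} (huv : K.F i u = some v) :
    ((K.h j v : ℤ) - K.t j v) = K.h j u - K.t j u + if Neighb i j then 1 else 0 := by
  have := ((hK.2.2.1 i (color_mem hK.1 huv) j hj hij).1 u v huv).2.2
  split_ifs at this ⊢ <;> omega

theorem edge_h_le {K : PreGraph} {n : ℕ} (hK : IsACrystal n K) {i j : ℕ} (hij : i ≠ j)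
    (hj : j ∈ Set.Icc 1 n) {u v : K.V} (huv : K.F i u = some v) : K.h j u ≤ K.h j v :=
  ((hK.2.2.1 i (color_mem hK.1 huv) j hj hij).1 u v huv).2.1

theorem edge_le_t_add_one {K : PreGraph} {n : ℕ} (hK : IsACrystal n K) {i j : ℕ} (hij : i ≠ j)
    {u v : K.V} (huv : K.F i u = some v) : K.t j u ≤ K.t j v + 1 := by
  by_cases hj : j ∈ Set.Icc 1 n
  · have h1 := edge_weight hK hij hj huv
    have h2 := edge_h_le hK hij hj huv
    split_ifs at h1 <;> omega
  · by_contra hlt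
    obtain ⟨w, hw⟩ := (t_pos_iff hK.1 (v := u) (i := j)).1 (by omega)
    exact hj (color_mem hK.1 hw)

theorem Neighb.symm {i j : ℕ} (h : Neighb i j) : Neighb j i := Or.symm h

theorem Neighb.ne {i j : ℕ} (h : Neighb i j) : i ≠ j := by
  rcases h with h | h <;> omega

theorem far_comm {K : PreGraph} {n : ℕ} (hK : IsACrystal n K) {i j : ℕ} (hij : Far i j)
    (u : K.V) : applyStr K [i, j] u = applyStr K [j, i] u := by
  have key : ∀ i j, Far i j → ∀ v, applyStr K [i, j] u = some v →
      applyStr K [j, i] u = some v := by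
    intro i j hij v huv
    simp only [applyStr, Option.bind_eq_some_iff] at huv ⊢
    obtain ⟨x, hux, y, hxy, hy⟩ := huv
    cases hy
    obtain ⟨w, hw1, hw2⟩ := hK.2.2.2.2 i (color_mem hK.1 hux) j (color_mem hK.1 hxy) hij
      (K.Finv i) (by simp) (K.F j) (by simp) x
      (by rw [(Finv_eq_some_iff hK.1).2 hux]; rfl) (by rw [hxy]; rfl)
    rw [(Finv_eq_some_iff hK.1).2 hux] at hw1
    rw [hxy] at hw2
    exact ⟨w, hw1, v, (Finv_eq_some_iff hK.1).1 hw2, rfl⟩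
  refine Option.ext fun v => ⟨key i j hij v, key j i (Or.symm hij) v⟩

/-- If a `j`-edge does not change the length of the outgoing `i`-path, then an `i`-edge leaving
its end completes to a commutative square. -/
theorem exists_parent_of_t_lt {K : PreGraph} {n : ℕ} (hK : IsACrystal n K) {i j : ℕ}
    (hij : Neighb i j) {p p' q : K.V} (hp : K.F j p' = some p) (hq : K.F i p = some q)
    (ht : K.t i p' = K.t i p + 1) : ∃ w, K.F j w = some q := by
  have hi := color_mem hK.1 hq
  have hj := color_mem hK.1 hp
  have h1 := edge_weight hK hij.symm.ne hi hp
  rw [if_pos hij.symm] at h1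
  have h2 : K.h i p = K.h i p' := by omega
  obtain ⟨r, hr⟩ := (h_pos_iff hK.1 (i := i) (v := p')).1
    (h2 ▸ (h_pos_iff hK.1).2 ⟨q, hq⟩)
  obtain ⟨-, w, hw1, hw2⟩ := (hK.2.2.2.1 j hj i hi hij.symm).1.1 p' p r hp hr h2
  rw [hq] at hw1
  cases hw1
  exact ⟨r, hw2⟩

/-- Two edges entering a vertex, one of them with label one. -/
theorem label_one {K : PreGraph} {n : ℕ} (hK : IsACrystal n K) {i j : ℕ}
    (hij : Neighb i j) {p p' q : K.V} (hp : K.F i p = some q) (hp' : K.F j p' = some q)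
    (ht : K.t j p = K.t j q) :
    K.t i p' = K.t i q + 1 ∧ ∃ w, K.F j w = some p ∧ K.F i w = some p' := by
  have hi := color_mem hK.1 hp
  have hj := color_mem hK.1 hp'
  have h1 := edge_weight hK hij.ne hj hp
  rw [if_pos hij] at h1
  obtain ⟨h2, h3⟩ := (hK.2.2.2.1 i hi j hj hij).1.2 p p' q hp hp' (by omega)
  have h4 := edge_weight hK hij.symm.ne hi hp'
  rw [if_pos hij.symm] at h4
  exact ⟨by omega, h3⟩

/-- Local confluence of the inverse operators. -/
theorem exists_common_ancestor {K : PreGraph} {n : ℕ} (hK : IsACrystal n K) {i j : ℕ}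
    (hij : i ≠ j) {p p' q : K.V} (hp : K.F i p = some q) (hp' : K.F j p' = some q) :
    ∃ w L L', (∀ k ∈ L, k = i ∨ k = j) ∧ (∀ k ∈ L', k = i ∨ k = j) ∧
      applyStr K L w = some p ∧ applyStr K L' w = some p' := by
  have hi := color_mem hK.1 hp
  have hj := color_mem hK.1 hp'
  have inv : ∀ {i u v}, K.F i u = some v → K.Finv i v = some u :=
    fun h => (Finv_eq_some_iff hK.1).2 h
  by_cases hn : Neighb i j
  · by_cases h1 : K.t j p = K.t j q
    · obtain ⟨-, w, hw, hw'⟩ := label_one hK hn hp hp' h1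
      exact ⟨w, [j], [i], by simp, by simp, by rwa [applyStr_singleton],
        by rwa [applyStr_singleton]⟩
    by_cases h2 : K.t i p' = K.t i q
    · obtain ⟨-, w, hw, hw'⟩ := label_one hK hn.symm hp' hp h2
      exact ⟨w, [j], [i], by simp, by simp, by rwa [applyStr_singleton],
        by rwa [applyStr_singleton]⟩
    have e1 := edge_weight hK hn.ne hj hp
    have e2 := edge_weight hK hn.symm.ne hi hp'
    rw [if_pos hn] at e1
    rw [if_pos hn.symm] at e2
    have := edge_t_le hK hn.ne hp
    have := edge_t_le hK hn.symm.ne hp'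
    have := edge_le_t_add_one hK hn.ne hp
    have := edge_le_t_add_one hK hn.symm.ne hp'
    obtain ⟨w, hw, hw'⟩ := (hK.2.2.2.1 i hi j hj hn).2.2 p p' q hp hp' (by omega) (by omega)
    simp only [inv hp, inv hp', Option.bind_eq_some_iff, Option.bind_some,
      Finv_eq_some_iff hK.1] at hw hw'
    obtain ⟨x, ⟨y, hy, hxy⟩, hwx⟩ := hw
    obtain ⟨x', ⟨y', hy', hxy'⟩, hwx'⟩ := hw'
    refine ⟨w, [i, j, j], [j, i, i], by simp, by simp, ?_, ?_⟩
    · simp [applyStr, hwx, hxy, hy]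
    · simp [applyStr, hwx', hxy', hy']
  · have hf : Far i j := by
      unfold Neighb at hn
      unfold Far
      omega
    obtain ⟨w, hw1, hw2⟩ := hK.2.2.2.2 i hi j hj hf (K.Finv i) (by simp) (K.Finv j) (by simp) q
      (by rw [inv hp]; rfl) (by rw [inv hp']; rfl)
    simp only [inv hp, inv hp', Option.bind_some, Finv_eq_some_iff hK.1] at hw1 hw2
    exact ⟨w, [j], [i], by simp, by simp, by rwa [applyStr_singleton],
        by rwa [applyStr_singleton]⟩

/-! ### Counting edges of each color -/

/-- `cnt k` counts edges of color `k`: it grows by one along `k`-edges and is constant along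
the edges of other colors. -/
def IsCount (K : PreGraph) (cnt : ℕ → K.V → ℤ) : Prop :=
  ∀ i u v, K.F i u = some v → ∀ k, cnt k v = cnt k u + if k = i then 1 else 0

/-- Up to the factor `n + 1`, the inverse of the Cartan matrix of type `A_n`. -/
def invCartan (n k i : ℕ) : ℤ :=
  if i ≤ k then (i : ℤ) * (n + 1 - k) else (k : ℤ) * (n + 1 - i)

theorem invCartan_spec (n k i : ℕ) :
    2 * invCartan n k (i + 1) - invCartan n k i - invCartan n k (i + 2) =
      if k = i + 1 then (n : ℤ) + 1 else 0 := by
  unfold invCartan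
  rcases lt_trichotomy k (i + 1) with h | h | h
  · rcases Nat.lt_succ_iff_lt_or_eq.1 h with h' | rfl
    · simp only [show ¬ i + 1 ≤ k by omega, show ¬ i ≤ k by omega, show ¬ i + 2 ≤ k by omega,
        show k ≠ i + 1 by omega, if_false]
      push_cast
      ring
    · simp only [show ¬ k + 1 ≤ k by omega, show ¬ k + 2 ≤ k by omega, le_refl,
        show k ≠ k + 1 by omega, if_false, if_true]
      push_cast
      ring
  · subst h
    simp only [show ¬ i + 2 ≤ i + 1 by omega, show i ≤ i + 1 by omega, le_refl, if_false, if_true]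
    push_cast
    ring
  · simp only [show i + 1 ≤ k by omega, show i ≤ k by omega, show i + 2 ≤ k by omega,
      show k ≠ i + 1 by omega, if_false, if_true]
    push_cast
    ring

theorem exists_isCount {K : PreGraph} {n : ℕ} (hK : IsACrystal n K) :
    ∃ cnt, IsCount K cnt := by
  refine ⟨fun k v => (if k ≤ n then
    -∑ i ∈ Finset.range (n + 2), invCartan n k i * ((K.h i v : ℤ) - K.t i v) else 0) / (n + 1),
    fun c u v huv k => ?_⟩
  have hc := color_mem hK.1 huv
  obtain ⟨c, rfl⟩ : ∃ d, c = d + 1 := ⟨c - 1, by have := hc.1; omega⟩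
  have hcn : c + 1 ≤ n := hc.2
  have hn : ((n : ℤ) + 1) ≠ 0 := by positivity
  by_cases hk : k ≤ n
  · simp only [if_pos hk]
    have hterm : ∀ i ∈ Finset.range (n + 2),
        invCartan n k i * ((K.h i v : ℤ) - K.t i v) =
        invCartan n k i * ((K.h i u : ℤ) - K.t i u) +
          ((if i = c + 1 then -2 * invCartan n k i else 0) +
            (if i = c then invCartan n k i else 0) +
            (if i = c + 2 then invCartan n k i else 0)) := by
      intro i hi
      rw [Finset.mem_range] at hi
      by_cases h0 : i = 0
      · have : invCartan n k i = 0 := by simp [h0, invCartan]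
        simp [this]
      by_cases h1 : i = n + 1
      · have : invCartan n k i = 0 := by
          simp [h1, invCartan, show ¬ n + 1 ≤ k by omega]
        simp [this]
      by_cases hic : i = c + 1
      · subst hic
        rw [h_eq_succ hK.1 huv, t_eq_succ hK.1 huv]
        simp
        ring
      · rw [edge_weight hK (Ne.symm hic) ⟨by omega, by omega⟩ huv]
        by_cases hic1 : i = c
        · subst hic1
          rw [if_pos (show Neighb (i + 1) i from Or.inr rfl)]
          simp
          ring
        · by_cases hic2 : i = c + 2
          · subst hic2
            rw [if_pos (show Neighb (c + 1) (c + 2) from Or.inl rfl)]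
            simp
            ring
          · rw [if_neg (show ¬ Neighb (c + 1) i by unfold Neighb; omega), if_neg hic, if_neg hic1,
              if_neg hic2]
            ring
    rw [Finset.sum_congr rfl hterm]
    simp only [Finset.sum_add_distrib, Finset.sum_ite_eq', Finset.mem_range]
    rw [if_pos (by omega), if_pos (by omega), if_pos (by omega)]
    have hs := invCartan_spec n k c
    generalize ∑ i ∈ Finset.range (n + 2), invCartan n k i * ((K.h i u : ℤ) - K.t i u) = S
    rw [show -(S + (-2 * invCartan n k (c + 1) + invCartan n k c + invCartan n k (c + 2))) =
      -S + (if k = c + 1 then (n : ℤ) + 1 else 0) by rw [← hs]; ring]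
    split_ifs
    · rw [Int.add_ediv_of_dvd_right dvd_rfl, Int.ediv_self hn]
    · simp
  · simp [if_neg hk, show k ≠ c + 1 by omega]

theorem IsCount.applyStr {K : PreGraph} {cnt : ℕ → K.V → ℤ} (hcnt : IsCount K cnt)
    {L : List ℕ} {u v : K.V} (h : applyStr K L u = some v) (k : ℕ) :
    cnt k v = cnt k u + L.count k := by
  induction L generalizing u with
  | nil =>
    cases h
    simp
  | cons i L ih =>
    obtain ⟨w, hw, hwv⟩ := Option.bind_eq_some_iff.1 h
    rw [ih hwv, hcnt i u w hw k, List.count_cons]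
    by_cases hk : k = i
    · simp [hk]
      ring
    · simp [hk, Ne.symm hk]

/-! ### Sources of subcrystals -/

theorem inComp_of_applyStr {K : PreGraph} {I : Set ℕ} {L : List ℕ} {u v : K.V}
    (hL : ∀ k ∈ L, k ∈ I) (h : applyStr K L u = some v) : inComp K I u v := by
  induction L generalizing u with
  | nil =>
    cases h
    exact Relation.ReflTransGen.refl
  | cons i L ih =>
    obtain ⟨w, hw, hwv⟩ := Option.bind_eq_some_iff.1 h
    exact Relation.ReflTransGen.head ⟨i, hL i (by simp), Or.inl hw⟩
      (ih (fun k hk => hL k (by simp [hk])) hwv)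

theorem inComp.symm {K : PreGraph} {I : Set ℕ} {u v : K.V} (h : inComp K I u v) :
    inComp K I v u := by
  induction h with
  | refl => exact Relation.ReflTransGen.refl
  | tail _ hxy ih =>
    obtain ⟨i, hi, hxy⟩ := hxy
    exact Relation.ReflTransGen.head ⟨i, hi, Or.symm hxy⟩ ih

theorem inComp.trans {K : PreGraph} {I : Set ℕ} {u v w : K.V} (h : inComp K I u v)
    (h' : inComp K I v w) : inComp K I u w :=
  Relation.ReflTransGen.trans h h'

theorem inComp.parent {K : PreGraph} {I : Set ℕ} {u v p : K.V} {i : ℕ} (h : inComp K I u v)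
    (hi : i ∈ I) (hp : K.F i p = some v) : inComp K I u p :=
  Relation.ReflTransGen.tail h ⟨i, hi, Or.inr hp⟩

/-- `v` is reachable from `u` along edges with colors in `I`. -/
def Below (K : PreGraph) (I : Set ℕ) (u v : K.V) : Prop :=
  ∃ L : List ℕ, (∀ k ∈ L, k ∈ I) ∧ applyStr K L u = some v

theorem Below.trans {K : PreGraph} {I : Set ℕ} {u v w : K.V} (h : Below K I u v)
    (h' : Below K I v w) : Below K I u w := by
  obtain ⟨L, hL, huv⟩ := h
  obtain ⟨M, hM, hvw⟩ := h'
  refine ⟨L ++ M, fun k hk => ?_, applyStr_append_eq_some.2 ⟨v, huv, hvw⟩⟩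
  rcases List.mem_append.1 hk with hk | hk
  · exact hL k hk
  · exact hM k hk

theorem Below.eq_or_parent {K : PreGraph} {I : Set ℕ} {u v : K.V} (h : Below K I u v) :
    u = v ∨ ∃ i ∈ I, ∃ p, K.F i p = some v ∧ Below K I u p := by
  obtain ⟨L, hL, huv⟩ := h
  rcases List.eq_nil_or_concat L with rfl | ⟨L, i, rfl⟩
  · left
    simpa [applyStr] using huv
  · right
    rw [List.concat_eq_append, applyStr_append_eq_some] at huv
    obtain ⟨p, hp, hpv⟩ := huv
    rw [applyStr_singleton] at hpv
    exact ⟨i, hL i (by simp), p, hpv, L, fun k hk => hL k (by simp [hk]), hp⟩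

theorem exists_height {K : PreGraph} {n : ℕ} (hK : IsACrystal n K) :
    ∃ ht : K.V → ℕ, ∀ i u v, K.F i u = some v → ht u < ht v := by
  obtain ⟨cnt, hcnt⟩ := exists_isCount hK
  have := hK.1.1
  obtain ⟨m, hm⟩ := (Set.finite_range fun v => ∑ k ∈ Finset.Icc 1 n, cnt k v).bddBelow
  refine ⟨fun v => (∑ k ∈ Finset.Icc 1 n, cnt k v - m).toNat, fun i u v huv => ?_⟩
  have hi := color_mem hK.1 huv
  have hv : ∑ k ∈ Finset.Icc 1 n, cnt k v = ∑ k ∈ Finset.Icc 1 n, cnt k u + 1 := by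
    rw [Finset.sum_congr rfl fun k _ => hcnt i u v huv k, Finset.sum_add_distrib,
      Finset.sum_ite_eq', if_pos (Finset.mem_Icc.2 hi)]
  have hu : m ≤ ∑ k ∈ Finset.Icc 1 n, cnt k u := hm ⟨u, rfl⟩
  simp only
  omega

theorem source_unique_above {K : PreGraph} {n : ℕ} (hK : IsACrystal n K) {I : Set ℕ}
    (v : K.V) : ∃ u, (∀ i ∈ I, K.t i u = 0) ∧ Below K I u v ∧
      ∀ w, (∀ i ∈ I, K.t i w = 0) → Below K I w v → w = u := by
  obtain ⟨ht, hht⟩ := exists_height hK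
  have no_parent : ∀ {i u p}, K.t i u = 0 → K.F i p ≠ some u := by
    intro i u p h hp
    have := t_eq_succ hK.1 hp
    omega
  induction hd : ht v using Nat.strong_induction_on generalizing v with
  | _ d ih =>
  subst hd
  by_cases hv : ∀ i ∈ I, K.t i v = 0
  · refine ⟨v, hv, ⟨[], by simp, rfl⟩, fun w hw hwv => ?_⟩
    rcases hwv.eq_or_parent with h | ⟨i, hi, p, hp, -⟩
    · exact h
    · exact absurd hp (no_parent (hv i hi))
  · push Not at hv
    obtain ⟨i, hi, hiv⟩ := hv
    obtain ⟨p, hp⟩ := (t_pos_iff hK.1).1 (Nat.pos_of_ne_zero hiv)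
    obtain ⟨u, hu, hup, huniq⟩ := ih _ (hht i p v hp) p rfl
    refine ⟨u, hu, hup.trans ⟨[i], by simpa using hi, by rwa [applyStr_singleton]⟩,
      fun w hw hwv => ?_⟩
    rcases hwv.eq_or_parent with rfl | ⟨j, hj, p', hp', hwp'⟩
    · exact absurd (hw i hi) hiv
    by_cases hij : i = j
    · subst hij
      obtain rfl := hK.1.2.2.1 i p p' v hp hp'
      exact huniq w hw hwp'
    obtain ⟨x, L, L', hL, hL', hxp, hxp'⟩ := exists_common_ancestor hK hij hp hp'
    have sub : ∀ {M : List ℕ}, (∀ k ∈ M, k = i ∨ k = j) → ∀ k ∈ M, k ∈ I := by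
      intro M hM k hk
      rcases hM k hk with rfl | rfl
      · exact hi
      · exact hj
    have hltx : ∀ {M : List ℕ} {y}, applyStr K M x = some y → ht x ≤ ht y := by
      intro M
      generalize x = x
      induction M generalizing x with
      | nil =>
        intro y h
        cases h
        exact le_rfl
      | cons k M ihM =>
        intro y h
        obtain ⟨z, hz, hzy⟩ := Option.bind_eq_some_iff.1 h
        exact (hht k x z hz).le.trans (ihM z hzy)
    obtain ⟨y, hy, hyx, -⟩ := ih _ ((hltx hxp).trans_lt (hht i p v hp)) x rfl
    obtain ⟨u', -, -, huniq'⟩ := ih _ (hht j p' v hp') p' rfl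
    rw [huniq' w hw hwp', ← huniq' y hy (hyx.trans ⟨L', sub hL', hxp'⟩)]
    exact huniq y hy (hyx.trans ⟨L, sub hL, hxp⟩)

theorem below_of_inComp {K : PreGraph} {n : ℕ} (hK : IsACrystal n K) {I : Set ℕ} {u v : K.V}
    (hu : ∀ i ∈ I, K.t i u = 0) (h : inComp K I u v) : Below K I u v := by
  induction h with
  | refl => exact ⟨[], by simp, rfl⟩
  | tail _ hstep ih =>
    rename_i x y _
    obtain ⟨i, hi, hxy | hyx⟩ := hstep
    · exact ih.trans ⟨[i], by simpa using hi, by rwa [applyStr_singleton]⟩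
    · obtain ⟨w, hw, hwy, -⟩ := source_unique_above hK (I := I) y
      obtain ⟨w', -, -, huniq⟩ := source_unique_above hK (I := I) x
      have hwx : Below K I w x :=
        hwy.trans ⟨[i], by simpa using hi, by rwa [applyStr_singleton]⟩
      rw [huniq u hu ih, ← huniq w hw hwx]
      exact hwy

theorem source_eq_of_inComp {K : PreGraph} {n : ℕ} (hK : IsACrystal n K) {I : Set ℕ} {u v : K.V}
    (hu : ∀ i ∈ I, K.t i u = 0) (hv : ∀ i ∈ I, K.t i v = 0) (h : inComp K I u v) : u = v := by
  rcases (below_of_inComp hK hu h).eq_or_parent with h | ⟨i, hi, p, hp, -⟩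
  · exact h
  · have := t_eq_succ hK.1 hp
    have := hv i hi
    omega

/-! ### Two neighboring colors -/

theorem IsCount.le_of_below {K : PreGraph} {cnt : ℕ → K.V → ℤ} (hcnt : IsCount K cnt) {I : Set ℕ}
    {u v : K.V} (h : Below K I u v) (k : ℕ) : cnt k u ≤ cnt k v := by
  obtain ⟨L, -, hL⟩ := h
  have := hcnt.applyStr hL k
  omega

theorem inComp.replicate_parent {K : PreGraph} {I : Set ℕ} {u v p : K.V} {i k : ℕ}
    (h : inComp K I u v) (hi : i ∈ I) (hp : applyStr K (List.replicate k i) p = some v) :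
    inComp K I u p :=
  h.trans (inComp_of_applyStr (fun j hj => by rwa [List.eq_of_mem_replicate hj]) hp).symm

theorem t_le_count {K : PreGraph} {n : ℕ} (hK : IsACrystal n K) {cnt : ℕ → K.V → ℤ}
    (hcnt : IsCount K cnt) {I : Set ℕ} {u q : K.V} (hu : ∀ k ∈ I, K.t k u = 0)
    (h : inComp K I u q) {i : ℕ} (hi : i ∈ I) : (K.t i q : ℤ) ≤ cnt i q - cnt i u := by
  obtain ⟨x, hx⟩ := (le_t_iff hK.1).1 (le_refl (K.t i q))
  have h1 := hcnt.applyStr hx i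
  have h2 := hcnt.le_of_below (below_of_inComp hK hu (h.replicate_parent hi hx)) i
  rw [List.count_replicate_self] at h1
  omega

theorem tails_eq_max_of_tail_zero {K : PreGraph} {n : ℕ} (hK : IsACrystal n K)
    {cnt : ℕ → K.V → ℤ} (hcnt : IsCount K cnt) {I : Set ℕ} {u q : K.V}
    (hu : ∀ k ∈ I, K.t k u = 0) {i j : ℕ} (hij : Neighb i j) (hi : i ∈ I) (hj : j ∈ I)
    (hq : inComp K I u q) {ht : K.V → ℕ} (hht : ∀ i u v, K.F i u = some v → ht u < ht v)
    (ih : ∀ p, ht p < ht q → inComp K I u p →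
      (K.t i p : ℤ) + K.t j p = max (cnt i p - cnt i u) (cnt j p - cnt j u))
    (hjq : K.t j q = 0) (hiq : 0 < K.t i q) :
    (K.t i q : ℤ) + K.t j q = max (cnt i q - cnt i u) (cnt j q - cnt j u) := by
  obtain ⟨p, hp⟩ := (t_pos_iff hK.1).1 hiq
  have hpc := hq.parent hi hp
  have ihp := ih p (hht _ _ _ hp) hpc
  have c1 := hcnt _ _ _ hp i
  have c2 := hcnt _ _ _ hp j
  rw [if_pos rfl] at c1
  rw [if_neg hij.ne.symm] at c2
  have t1 := t_eq_succ hK.1 hp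
  have t2 := edge_le_t_add_one hK hij.ne hp
  by_cases h0 : K.t j p = 0
  · have := t_le_count hK hcnt hu hpc hi
    omega
  obtain ⟨r, hr⟩ := (t_pos_iff hK.1).1 (Nat.pos_of_ne_zero h0)
  have ihr := ih r ((hht _ _ _ hr).trans (hht _ _ _ hp)) (hpc.parent hj hr)
  have c3 := hcnt _ _ _ hr i
  have c4 := hcnt _ _ _ hr j
  rw [if_pos rfl] at c4
  rw [if_neg hij.ne] at c3
  have t3 := t_eq_succ hK.1 hr
  have t4 := edge_le_t_add_one hK hij.symm.ne hr
  have t5 := edge_t_le hK hij.symm.ne hr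
  by_cases h1 : K.t i r = K.t i p + 1
  · have := (t_pos_iff hK.1).2 (exists_parent_of_t_lt hK hij hr hp h1)
    omega
  omega

/-- In a two-colored subcrystal, the tails of a vertex are controlled by the numbers of edges of
both colors on a path from the source. -/
theorem tails_eq_max {K : PreGraph} {n : ℕ} (hK : IsACrystal n K)
    {cnt : ℕ → K.V → ℤ} (hcnt : IsCount K cnt) {u q : K.V} {i j : ℕ} (hij : Neighb i j)
    (hui : K.t i u = 0) (huj : K.t j u = 0) (hq : inComp K {i, j} u q) :
    (K.t i q : ℤ) + K.t j q = max (cnt i q - cnt i u) (cnt j q - cnt j u) := by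
  obtain ⟨ht, hht⟩ := exists_height hK
  have hu : ∀ k ∈ ({i, j} : Set ℕ), K.t k u = 0 := by
    rintro k (rfl | rfl)
    · exact hui
    · exact huj
  have hi : i ∈ ({i, j} : Set ℕ) := by simp
  have hj : j ∈ ({i, j} : Set ℕ) := by simp
  induction hd : ht q using Nat.strong_induction_on generalizing q with
  | _ d ih =>
  subst hd
  have ih' : ∀ p, ht p < ht q → inComp K {i, j} u p →
      (K.t i p : ℤ) + K.t j p = max (cnt i p - cnt i u) (cnt j p - cnt j u) :=
    fun p hp hup => ih _ hp hup rfl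
  rcases Nat.eq_zero_or_pos (K.t j q) with hj0 | hj0 <;>
    rcases Nat.eq_zero_or_pos (K.t i q) with hi0 | hi0
  · have : u = q := source_eq_of_inComp hK hu (by
      rintro k (rfl | rfl)
      · exact hi0
      · exact hj0) hq
    subst this
    simp [hi0, hj0]
  · exact tails_eq_max_of_tail_zero hK hcnt hu hij hi hj hq hht ih' hj0 hi0
  · rw [add_comm, max_comm]
    refine tails_eq_max_of_tail_zero hK hcnt hu hij.symm hj hi hq hht (fun p hp hup => ?_) hi0 hj0
    rw [add_comm, max_comm]
    exact ih' p hp hup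
  · obtain ⟨p, hp⟩ := (t_pos_iff hK.1).1 hi0
    obtain ⟨r, hr⟩ := (t_pos_iff hK.1).1 hj0
    have e1 := ih' p (hht _ _ _ hp) (hq.parent hi hp)
    have e2 := ih' r (hht _ _ _ hr) (hq.parent hj hr)
    have c1 := hcnt _ _ _ hp i
    have c2 := hcnt _ _ _ hp j
    have c3 := hcnt _ _ _ hr i
    have c4 := hcnt _ _ _ hr j
    rw [if_pos rfl] at c1 c4
    rw [if_neg hij.ne.symm] at c2
    rw [if_neg hij.ne] at c3
    have t1 := t_eq_succ hK.1 hp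
    have t2 := t_eq_succ hK.1 hr
    have t3 := edge_le_t_add_one hK hij.ne hp
    have t4 := edge_le_t_add_one hK hij.symm.ne hr
    have t5 := edge_t_le hK hij.ne hp
    have t6 := edge_t_le hK hij.symm.ne hr
    have l1 : K.t j p = K.t j q → K.t i r = K.t i q + 1 := fun h => (label_one hK hij hp hr h).1
    have l2 : K.t i r = K.t i q → K.t j p = K.t j q + 1 :=
      fun h => (label_one hK hij.symm hr hp h).1
    omega

theorem t_applyStr_le {K : PreGraph} {n : ℕ} (hK : IsACrystal n K) {k : ℕ} {L : List ℕ}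
    (hk : k ∉ L) {u v : K.V} (h : applyStr K L u = some v) : K.t k v ≤ K.t k u := by
  induction L generalizing u with
  | nil =>
    cases h
    exact le_rfl
  | cons i L ih =>
    obtain ⟨w, hw, hwv⟩ := Option.bind_eq_some_iff.1 h
    rw [List.mem_cons, not_or] at hk
    exact (ih hk.2 hwv).trans (edge_t_le hK (Ne.symm hk.1) hw)

theorem t_applyStr_replicate {K : PreGraph} {C : Set ℕ} (hK : IsColored K C) {i k : ℕ}
    {u v : K.V} (h : applyStr K (List.replicate k i) u = some v) : K.t i v = K.t i u + k := by
  induction k generalizing u with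
  | zero =>
    cases h
    rfl
  | succ k ih =>
    obtain ⟨w, hw, hwv⟩ := Option.bind_eq_some_iff.1 h
    rw [ih hwv, t_eq_succ hK hw]
    omega

theorem exists_applyStr_replicate {K : PreGraph} {C : Set ℕ} (hK : IsColored K C) {i : ℕ}
    (v : K.V) : ∃ u, applyStr K (List.replicate (K.t i v) i) u = some v ∧ K.t i u = 0 := by
  obtain ⟨u, hu⟩ := (le_t_iff hK).1 (le_refl (K.t i v))
  have := t_applyStr_replicate hK hu
  exact ⟨u, hu, by omega⟩

theorem t_eq_zero_of_le {K : PreGraph} {n : ℕ} (hK : IsACrystal n K) {u q : K.V} {i j w y : ℕ}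
    (hij : Neighb i j) (hui : K.t i u = 0) (huj : K.t j u = 0) (hwy : w ≤ y)
    (h : applyStr K (List.replicate w i ++ List.replicate y j) u = some q) : K.t i q = 0 := by
  obtain ⟨cnt, hcnt⟩ := exists_isCount hK
  have hc : inComp K {i, j} u q := inComp_of_applyStr (fun k hk => by
    simp only [List.mem_append, List.mem_replicate] at hk
    rcases hk with hk | hk <;> simp [hk.2]) h
  have e := tails_eq_max hK hcnt hij hui huj hc
  have c1 := hcnt.applyStr h i
  have c2 := hcnt.applyStr h j
  simp only [List.count_append, List.count_replicate, beq_iff_eq, if_true, hij.ne, hij.symm.ne,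
    if_false] at c1 c2
  obtain ⟨x, -, hx⟩ := applyStr_append_eq_some.1 h
  have := t_applyStr_replicate hK.1 hx
  omega

/-- The exponents of two equal words `i^w j^y i^x` and `j^w' i^y' j^x'` at a source. -/
def Braid (w y x w' y' x' : ℕ) : Prop :=
  w ≤ y ∧ y' = x + w ∧ x' + w' = y ∧ w' = min x (y - w)

theorem Braid.symm {w y x w' y' x' : ℕ} (h : Braid w y x w' y' x') : Braid w' y' x' w y x := by
  unfold Braid at *
  omega

theorem Braid.applyStr_eq_some {K : PreGraph} {n : ℕ} (hK : IsACrystal n K) {u q : K.V}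
    {i j : ℕ} (hij : Neighb i j) (hui : K.t i u = 0) (huj : K.t j u = 0)
    {w y x w' y' x' : ℕ} (hb : Braid w y x w' y' x')
    (h : applyStr K (List.replicate w i ++ (List.replicate y j ++ List.replicate x i)) u = some q) :
    applyStr K (List.replicate w' j ++ (List.replicate y' i ++ List.replicate x' j)) u = some q := by
  obtain ⟨cnt, hcnt⟩ := exists_isCount hK
  have hi : i ∈ ({i, j} : Set ℕ) := by simp
  have hj : j ∈ ({i, j} : Set ℕ) := by simp
  have hu : ∀ k ∈ ({i, j} : Set ℕ), K.t k u = 0 := by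
    rintro k (rfl | rfl)
    · exact hui
    · exact huj
  have hc : inComp K {i, j} u q := inComp_of_applyStr (fun k hk => by
    simp only [List.mem_append, List.mem_replicate] at hk
    rcases hk with hk | hk | hk <;> simp [hk.2]) h
  have c1 := hcnt.applyStr h i
  have c2 := hcnt.applyStr h j
  simp only [List.count_append, List.count_replicate, beq_iff_eq, if_true, hij.ne, hij.symm.ne,
    if_false] at c1 c2
  have tq : K.t i q = x := by
    rw [← List.append_assoc] at h
    obtain ⟨r, hr, hrq⟩ := applyStr_append_eq_some.1 h
    have := t_applyStr_replicate hK.1 hrq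
    have := t_eq_zero_of_le hK hij hui huj hb.1 hr
    omega
  have eq := tails_eq_max hK hcnt hij hui huj hc
  obtain ⟨r, hr, hr0⟩ := exists_applyStr_replicate hK.1 (i := j) q
  have hrc := hc.replicate_parent hj hr
  have er := tails_eq_max hK hcnt hij hui huj hrc
  have c3 := hcnt.applyStr hr i
  have c4 := hcnt.applyStr hr j
  simp only [List.count_replicate, beq_iff_eq, if_true, hij.symm.ne, if_false] at c3 c4
  obtain ⟨p, hp, hp0⟩ := exists_applyStr_replicate hK.1 (i := i) r
  have hpc := hrc.replicate_parent hi hp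
  have ep := tails_eq_max hK hcnt hij hui huj hpc
  have c5 := hcnt.applyStr hp i
  have c6 := hcnt.applyStr hp j
  simp only [List.count_replicate, beq_iff_eq, if_true, hij.ne, if_false] at c5 c6
  obtain ⟨o, ho, ho0⟩ := exists_applyStr_replicate hK.1 (i := j) p
  have hoc := hpc.replicate_parent hj ho
  have c7 := hcnt.applyStr ho i
  have c8 := hcnt.applyStr ho j
  simp only [List.count_replicate, beq_iff_eq, if_true, hij.symm.ne, if_false] at c7 c8
  have lo := t_le_count hK hcnt hu hpc hj
  obtain ⟨b1, b2, b3, b4⟩ := hb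
  have hoi : K.t i o = 0 := by
    have := tails_eq_max hK hcnt hij hui huj hoc
    omega
  have huo : u = o := source_eq_of_inComp hK hu (by
      rintro k (rfl | rfl)
      · exact hoi
      · exact ho0) hoc
  subst huo
  rw [applyStr_append_eq_some]
  refine ⟨p, ?_, ?_⟩
  · rwa [show w' = K.t j p by omega]
  rw [applyStr_append_eq_some]
  refine ⟨r, ?_, ?_⟩
  · rwa [show y' = K.t i r by omega]
  · rwa [show x' = K.t j q by omega]

theorem Braid.applyStr_eq {K : PreGraph} {n : ℕ} (hK : IsACrystal n K) {u : K.V}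
    {i j : ℕ} (hij : Neighb i j) (hui : K.t i u = 0) (huj : K.t j u = 0)
    {w y x w' y' x' : ℕ} (hb : Braid w y x w' y' x') :
    applyStr K (List.replicate w i ++ (List.replicate y j ++ List.replicate x i)) u =
    applyStr K (List.replicate w' j ++ (List.replicate y' i ++ List.replicate x' j)) u :=
  Option.ext fun _ => ⟨hb.applyStr_eq_some hK hij hui huj,
    hb.symm.applyStr_eq_some hK hij.symm huj hui⟩

/-! ### Commutation of strings -/

theorem applyStr_cons_comm {K : PreGraph} {n : ℕ} (hK : IsACrystal n K) {i : ℕ} {L : List ℕ}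
    (h : ∀ j ∈ L, Far i j) (u : K.V) : applyStr K (i :: L) u = applyStr K (L ++ [i]) u := by
  induction L generalizing u with
  | nil => rfl
  | cons j L ih =>
    have h1 : applyStr K ([i, j] ++ L) u = applyStr K ([j, i] ++ L) u :=
      applyStr_congr_left L (far_comm hK (h j (by simp)) u)
    refine h1.trans ?_
    exact applyStr_congr_right [j] fun w _ => ih (fun k hk => h k (by simp [hk])) w

theorem applyStr_append_comm {K : PreGraph} {n : ℕ} (hK : IsACrystal n K) {L M : List ℕ}
    (h : ∀ i ∈ L, ∀ j ∈ M, Far i j) (u : K.V) :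
    applyStr K (L ++ M) u = applyStr K (M ++ L) u := by
  induction L generalizing u with
  | nil => simp
  | cons i L ih =>
    have h1 : applyStr K ([i] ++ (L ++ M)) u = applyStr K ([i] ++ (M ++ L)) u :=
      applyStr_congr_right [i] fun w _ => ih (fun k hk => h k (by simp [hk])) w
    refine h1.trans ?_
    have h2 := applyStr_congr_left L (applyStr_cons_comm hK (h i (by simp)) u)
    simpa using h2

/-! ### Increasing and decreasing words -/

/-- The word applying `e (o+1)` times the color `o+1`, then `e (o+2)` times `o+2`, up to `o+m`. -/
def upStr (o : ℕ) : ℕ → (ℕ → ℕ) → List ℕ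
  | 0, _ => []
  | m + 1, e => upStr o m e ++ List.replicate (e (o + m + 1)) (o + m + 1)

/-- The word applying `e (o+m)` times the color `o+m`, then lower colors, down to `o+1`. -/
def downStr (o : ℕ) : ℕ → (ℕ → ℕ) → List ℕ
  | 0, _ => []
  | m + 1, e => List.replicate (e (o + m + 1)) (o + m + 1) ++ downStr o m e

theorem mem_upStr {o m k : ℕ} {e : ℕ → ℕ} (h : k ∈ upStr o m e) : o < k ∧ k ≤ o + m := by
  induction m with
  | zero => simp [upStr] at h
  | succ m ih =>
    simp only [upStr, List.mem_append, List.mem_replicate] at h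
    rcases h with h | h
    · have := ih h
      omega
    · omega

theorem mem_downStr {o m k : ℕ} {e : ℕ → ℕ} (h : k ∈ downStr o m e) : o < k ∧ k ≤ o + m := by
  induction m with
  | zero => simp [downStr] at h
  | succ m ih =>
    simp only [downStr, List.mem_append, List.mem_replicate] at h
    rcases h with h | h
    · omega
    · have := ih h
      omega

theorem downStr_succ_append (o m : ℕ) (e : ℕ → ℕ) :
    downStr o (m + 1) e = downStr (o + 1) m e ++ List.replicate (e (o + 1)) (o + 1) := by
  induction m with
  | zero => simp [downStr]
  | succ m ih =>
    rw [downStr, ih, downStr, List.append_assoc, show o + (m + 1) + 1 = o + 1 + m + 1 by omega]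

/-- No edge with color in `(o, o+m]` enters `u`. -/
def IsSourceOn (K : PreGraph) (o m : ℕ) (u : K.V) : Prop :=
  ∀ k, o < k → k ≤ o + m → K.t k u = 0

theorem IsSourceOn.mono {K : PreGraph} {o m o' m' : ℕ} {u : K.V} (h : IsSourceOn K o m u)
    (h1 : o ≤ o') (h2 : o' + m' ≤ o + m) : IsSourceOn K o' m' u :=
  fun k hk hk' => h k (by omega) (by omega)

theorem t_eq_zero_applyStr {K : PreGraph} {n : ℕ} (hK : IsACrystal n K) {k : ℕ} {L : List ℕ}
    {u v : K.V} (h : applyStr K L u = some v) (hk : k ∉ L) (hu : K.t k u = 0) : K.t k v = 0 :=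
  Nat.le_zero.1 (hu ▸ t_applyStr_le hK hk h)

theorem IsSourceOn.upStr {K : PreGraph} {n : ℕ} (hK : IsACrystal n K) {o m : ℕ} {u v : K.V}
    (hu : IsSourceOn K o (m + 1) u) {e : ℕ → ℕ} (he : ∀ k, o < k → k ≤ o + m → e k ≤ e (k + 1))
    (h : applyStr K (upStr o (m + 1) e) u = some v) : IsSourceOn K o m v := by
  induction m generalizing v with
  | zero =>
    intro k h1 h2
    omega
  | succ m ih =>
    rw [_root_.upStr, applyStr_append_eq_some] at h
    obtain ⟨x, hx, hxv⟩ := h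
    have hsx := ih (hu.mono le_rfl (by omega)) (fun k h1 h2 => he k h1 (by omega)) hx
    intro k h1 h2
    by_cases hk : k = o + m + 1
    · subst hk
      rw [_root_.upStr, applyStr_append_eq_some] at hx
      obtain ⟨y, hy, hyx⟩ := hx
      refine t_eq_zero_of_le hK (i := o + m + 1) (j := o + m + 2) (u := y) (Or.inl rfl) ?_ ?_
        (he _ h1 (by omega)) (applyStr_append_eq_some.2 ⟨x, hyx, hxv⟩)
      · refine t_eq_zero_applyStr hK hy (fun hm => ?_) (hu _ (by omega) (by omega))
        have := mem_upStr hm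
        omega
      · refine t_eq_zero_applyStr hK hy (fun hm => ?_) (hu _ (by omega) (by omega))
        have := mem_upStr hm
        omega
    · refine t_eq_zero_applyStr hK hxv (fun hm => ?_) (hsx k h1 (by omega))
      have := List.eq_of_mem_replicate hm
      omega

theorem IsSourceOn.downStr {K : PreGraph} {n : ℕ} (hK : IsACrystal n K) {o m : ℕ} {u v : K.V}
    (hu : IsSourceOn K o (m + 1) u) {e : ℕ → ℕ} (he : ∀ k, o < k → k ≤ o + m → e (k + 1) ≤ e k)
    (h : applyStr K (downStr o (m + 1) e) u = some v) : IsSourceOn K (o + 1) m v := by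
  induction m generalizing v o with
  | zero =>
    intro k h1 h2
    omega
  | succ m ih =>
    rw [downStr_succ_append, applyStr_append_eq_some] at h
    obtain ⟨x, hx, hxv⟩ := h
    have hsx := ih (hu.mono (by omega) (by omega)) (fun k h1 h2 => he k (by omega) (by omega)) hx
    intro k h1 h2
    by_cases hk : k = o + 2
    · subst hk
      rw [downStr_succ_append, applyStr_append_eq_some] at hx
      obtain ⟨y, hy, hyx⟩ := hx
      refine t_eq_zero_of_le hK (i := o + 2) (j := o + 1) (u := y) (Or.inr rfl) ?_ ?_
        (he _ (by omega) (by omega)) (applyStr_append_eq_some.2 ⟨x, hyx, hxv⟩)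
      · refine t_eq_zero_applyStr hK hy (fun hm => ?_) (hu _ (by omega) (by omega))
        have := mem_downStr hm
        omega
      · refine t_eq_zero_applyStr hK hy (fun hm => ?_) (hu _ (by omega) (by omega))
        have := mem_downStr hm
        omega
    · refine t_eq_zero_applyStr hK hxv (fun hm => ?_) (hsx k (by omega) (by omega))
      have := List.eq_of_mem_replicate hm
      omega

/-- An increasing word followed by a decreasing one is equivalent to a decreasing word followed
by an increasing one. -/
theorem mountain_eq_valley {K : PreGraph} {n : ℕ} (hK : IsACrystal n K) {o m : ℕ} {u : K.V}
    (hu : IsSourceOn K o (m + 1) u) {A M P B Q : ℕ → ℕ} (hB : B (o + 1) = M (o + 1))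
    (hb : ∀ k, o < k → k ≤ o + m → Braid (A k) (M (k + 1)) (P k) (B (k + 1)) (M k) (Q (k + 1))) :
    applyStr K (upStr o m A ++ (List.replicate (M (o + m + 1)) (o + m + 1) ++ downStr o m P)) u =
      applyStr K (downStr o (m + 1) B ++ upStr (o + 1) m Q) u := by
  induction m generalizing u with
  | zero => simp [upStr, downStr, hB]
  | succ m ih =>
    have hb1 := hb (o + m + 1) (by omega) (by omega)
    have s1 := applyStr_congr_right (M := List.replicate (A (o + m + 1)) (o + m + 1) ++
        (List.replicate (M (o + m + 2)) (o + m + 2) ++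
          List.replicate (P (o + m + 1)) (o + m + 1))) (upStr o m A) (fun w hw =>
        hb1.applyStr_eq hK (Or.inl rfl)
        (t_eq_zero_applyStr hK hw (fun hm => by have := mem_upStr hm; omega)
          (hu _ (by omega) (by omega)))
        (t_eq_zero_applyStr hK hw (fun hm => by have := mem_upStr hm; omega)
          (hu _ (by omega) (by omega))))
    have s2 := applyStr_congr_left (downStr o m P) s1
    have s3 := applyStr_append_comm hK (L := upStr o m A)
      (M := List.replicate (B (o + m + 2)) (o + m + 2)) (fun i hi j hj => by
        have := mem_upStr hi
        have := List.eq_of_mem_replicate hj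
        left
        omega) u
    have s4 := fun v => applyStr_append_comm hK (M := downStr o m P)
      (L := List.replicate (Q (o + m + 2)) (o + m + 2)) (fun i hi j hj => by
        have := mem_downStr hj
        have := List.eq_of_mem_replicate hi
        right
        omega) v
    have s5 := applyStr_congr_left (List.replicate (M (o + m + 1)) (o + m + 1) ++
      (List.replicate (Q (o + m + 2)) (o + m + 2) ++ downStr o m P)) s3
    have s6 := applyStr_congr_right (u := u) (List.replicate (B (o + m + 2)) (o + m + 2) ++
      (upStr o m A ++ List.replicate (M (o + m + 1)) (o + m + 1))) (fun w _ => s4 w)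
    have s7 := applyStr_congr_right (List.replicate (B (o + m + 2)) (o + m + 2)) (fun w hw =>
      ih (u := w) (fun k h1 h2 => t_eq_zero_applyStr hK hw (fun hm => by
        have := List.eq_of_mem_replicate hm; omega) (hu k h1 (by omega)))
        (fun k h1 h2 => hb k h1 (by omega)))
    have s8 := applyStr_congr_left (List.replicate (Q (o + m + 2)) (o + m + 2)) s7
    simp only [List.append_assoc] at s2 s5 s6 s8
    have e1 : o + (m + 1) + 1 = o + m + 2 := by omega
    have e2 : o + 1 + m + 1 = o + m + 2 := by omega
    rw [upStr, upStr, downStr.eq_def o (m + 1) P, downStr.eq_def o (m + 1 + 1) B, e1, e2]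
    simp only [List.append_assoc]
    exact s2.trans (s5.trans (s6.trans s8))

/-- The word `(o+2)^{w (o+2)} (o+1)^{z (o+1)} (o+3)^{w (o+3)} (o+2)^{z (o+2)} ⋯`. -/
def zigStr (o : ℕ) : ℕ → (ℕ → ℕ) → (ℕ → ℕ) → List ℕ
  | 0, _, _ => []
  | m + 1, w, z => zigStr o m w z ++ (List.replicate (w (o + m + 2)) (o + m + 2) ++
      List.replicate (z (o + m + 1)) (o + m + 1))

theorem mem_zigStr {o m k : ℕ} {w z : ℕ → ℕ} (h : k ∈ zigStr o m w z) :
    o < k ∧ k ≤ o + m + 1 := by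
  induction m with
  | zero => simp [zigStr] at h
  | succ m ih =>
    simp only [zigStr, List.mem_append, List.mem_replicate] at h
    rcases h with h | h | h
    · have := ih h
      omega
    · omega
    · omega

theorem t_zigStr_eq_zero {K : PreGraph} {n : ℕ} (hK : IsACrystal n K) {o m : ℕ} {u v : K.V}
    (hu : IsSourceOn K o (m + 1) u) {w z : ℕ → ℕ}
    (hwz : ∀ k, o < k → k ≤ o + m → w (k + 1) ≤ z k)
    (h : applyStr K (zigStr o m w z) u = some v) : K.t (o + m + 1) v = 0 := by
  induction m generalizing v with
  | zero =>
    cases h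
    exact hu _ (by omega) (by omega)
  | succ m ih =>
    rw [zigStr, applyStr_append_eq_some] at h
    obtain ⟨x, hx, hxv⟩ := h
    refine t_eq_zero_of_le hK (i := o + m + 2) (j := o + m + 1) (Or.inr rfl) ?_
      (ih (hu.mono le_rfl (by omega)) (fun k h1 h2 => hwz k h1 (by omega)) hx)
      (hwz _ (by omega) (by omega)) hxv
    refine t_eq_zero_applyStr hK hx (fun hm => ?_) (hu _ (by omega) (by omega))
    have := mem_zigStr hm
    omega

theorem upStr_append_upStr_eq_zigStr {K : PreGraph} {n : ℕ} (hK : IsACrystal n K) {o m : ℕ}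
    {u : K.V} (hu : IsSourceOn K o (m + 1) u) {A P y w z : ℕ → ℕ} (hy : y (o + 1) = A (o + 1))
    (hb : ∀ k, o < k → k ≤ o + m →
      Braid (y k) (A (k + 1)) (P k) (w (k + 1)) (z k) (y (k + 1))) :
    applyStr K (upStr o (m + 1) A ++ upStr o m P) u =
      applyStr K (zigStr o m w z ++ List.replicate (y (o + m + 1)) (o + m + 1)) u := by
  induction m generalizing u with
  | zero => simp [upStr, zigStr, hy]
  | succ m ih =>
    have hb1 := hb (o + m + 1) (by omega) (by omega)
    have s1 := fun v => applyStr_append_comm hK (M := upStr o m P)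
      (L := List.replicate (A (o + m + 2)) (o + m + 2)) (fun i hi j hj => by
        have := mem_upStr hj
        have := List.eq_of_mem_replicate hi
        right
        omega) v
    have s2 := applyStr_congr_right (u := u) (upStr o (m + 1) A) (fun w _ => s1 w)
    have s3 := applyStr_congr_left (List.replicate (P (o + m + 1)) (o + m + 1)) s2
    have s4 := applyStr_congr_left (List.replicate (A (o + m + 2)) (o + m + 2) ++
      List.replicate (P (o + m + 1)) (o + m + 1))
      (ih (hu.mono le_rfl (by omega)) (fun k h1 h2 => hb k h1 (by omega)))
    have s5 := applyStr_congr_right (M := List.replicate (y (o + m + 1)) (o + m + 1) ++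
        (List.replicate (A (o + m + 2)) (o + m + 2) ++
          List.replicate (P (o + m + 1)) (o + m + 1))) (zigStr o m w z) (fun v hv =>
        hb1.applyStr_eq hK (Or.inl rfl)
        (t_zigStr_eq_zero hK (hu.mono le_rfl (by omega))
          (fun k h1 h2 => (hb k h1 (by omega)).symm.1) hv)
        (t_eq_zero_applyStr hK hv (fun hm => by have := mem_zigStr hm; omega)
          (hu _ (by omega) (by omega))))
    have e1 : o + (m + 1) + 1 = o + m + 2 := by omega
    rw [upStr, upStr.eq_def o (m + 1) P, zigStr, e1]
    simp only [List.append_assoc] at s3 s4 s5 ⊢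
    exact s3.trans (s4.trans s5)

/-! ### The strings of principal vertices -/

/-- Sum of `a` over `(o, k]`. -/
def headSum (o : ℕ) (a : ℕ → ℕ) (k : ℕ) : ℕ := ∑ j ∈ Finset.Ioc o k, a j

/-- Sum of `a` over `[k, e]`. -/
def tailSum (e : ℕ) (a : ℕ → ℕ) (k : ℕ) : ℕ := ∑ j ∈ Finset.Icc k e, a j

theorem headSum_self (o : ℕ) (a : ℕ → ℕ) : headSum o a o = 0 := by
  simp [headSum]

theorem headSum_succ {o k : ℕ} (h : o ≤ k) (a : ℕ → ℕ) :
    headSum o a (k + 1) = headSum o a k + a (k + 1) :=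
  Finset.sum_Ioc_succ_top h a

theorem tailSum_of_lt {e k : ℕ} (h : e < k) (a : ℕ → ℕ) : tailSum e a k = 0 := by
  simp [tailSum, Finset.Icc_eq_empty_of_lt h]

theorem tailSum_eq {e k : ℕ} (h : k ≤ e) (a : ℕ → ℕ) :
    tailSum e a k = a k + tailSum e a (k + 1) := by
  rw [tailSum, tailSum, ← Finset.add_sum_Ioc_eq_sum_Icc h, Finset.Icc_add_one_left_eq_Ioc]

theorem headSum_add_tailSum {o m k : ℕ} (a : ℕ → ℕ) (h1 : o ≤ k) (h2 : k ≤ o + m) :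
    headSum o a k + tailSum (o + m) a (k + 1) = headSum o a (o + m) := by
  induction hd : o + m - k generalizing k with
  | zero =>
    obtain rfl : k = o + m := by omega
    rw [tailSum_of_lt (by omega), add_zero]
  | succ d ih =>
    rw [← ih (k := k + 1) (by omega) (by omega) (by omega), headSum_succ h1,
      tailSum_eq (k := k + 1) (by omega)]
    ring

theorem headSum_shift {o k : ℕ} (h : o ≤ k) (a : ℕ → ℕ) :
    headSum o (fun i => a (i + 1)) k + a (o + 1) = headSum o a (k + 1) := by
  induction k, h using Nat.le_induction with
  | base => rw [headSum_self, headSum_succ le_rfl, headSum_self]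
  | succ k h ih => rw [headSum_succ h, headSum_succ (by omega : o ≤ k + 1), ← ih]; ring

theorem headSum_pred {o k : ℕ} (h : o ≤ k) (a : ℕ → ℕ) :
    headSum (o + 1) (fun i => a (i - 1)) (k + 1) = headSum o a k := by
  induction k, h using Nat.le_induction with
  | base => rw [headSum_self, headSum_self]
  | succ k h ih => rw [headSum_succ (by omega), headSum_succ h, ih]; simp

theorem tailSum_shift {e k : ℕ} (h : k ≤ e + 1) (a : ℕ → ℕ) :
    tailSum e (fun i => a (i + 1)) k = tailSum (e + 1) a (k + 1) := by
  induction hd : e + 1 - k generalizing k with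
  | zero => rw [tailSum_of_lt (by omega), tailSum_of_lt (by omega)]
  | succ d ih =>
    rw [tailSum_eq (by omega), tailSum_eq (by omega : k + 1 ≤ e + 1), ih (by omega) (by omega)]

/-- Increase `a` by one at the color `c`. -/
def addUnit (a : ℕ → ℕ) (c : ℕ) : ℕ → ℕ := fun i => a i + if i = c then 1 else 0

theorem headSum_addUnit {o c k : ℕ} (hc : o < c) (h : o ≤ k) (a : ℕ → ℕ) :
    headSum o (addUnit a c) k = headSum o a k + if c ≤ k then 1 else 0 := by
  induction k, h using Nat.le_induction with
  | base => rw [headSum_self, headSum_self, if_neg (by omega)]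
  | succ k h ih =>
    rw [headSum_succ h, headSum_succ h, ih, addUnit]
    split_ifs <;> omega

/-- The string `S_{m,k}`, empty for `k > m`. -/
def SStr₀ (o m k : ℕ) : List ℕ :=
  (List.range (m + 1 - k)).flatMap fun jm => wStr o k (jm + 1)

theorem SStr_eq_SStr₀ {o m k : ℕ} (h : k ≤ m) : SStr o m k = SStr₀ o m k := by
  rw [SStr, SStr₀, Nat.sub_add_comm h]

theorem SStr₀_of_lt {o m k : ℕ} (h : m < k) : SStr₀ o m k = [] := by
  simp [SStr₀, show m + 1 - k = 0 by omega]

theorem wStr_zero (o j : ℕ) : wStr o 0 j = [] := rfl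

theorem SStr₀_zero (o m : ℕ) : SStr₀ o m 0 = [] := by
  simp [SStr₀, wStr_zero]

theorem wStr_succ (o k j : ℕ) : wStr o (k + 1) j = (o + j + k) :: wStr o k j := by
  rw [wStr, List.range_succ_eq_map, List.map_cons, List.map_map, wStr]
  congr 1
  apply List.map_congr_left
  intro m _
  simp only [Function.comp]
  omega

theorem SStr₀_succ {o m k : ℕ} (h : k ≤ m + 1) :
    SStr₀ o (m + 1) k = SStr₀ o m k ++ wStr o k (m + 2 - k) := by
  rw [SStr₀, show m + 1 + 1 - k = m + 1 - k + 1 by omega, List.range_succ, List.flatMap_append,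
    SStr₀]
  simp [show m + 1 - k + 1 = m + 2 - k by omega]

theorem SStr₀_succ_succ {o m k : ℕ} (h : k ≤ m) :
    SStr₀ o (m + 1) (k + 1) = SStr₀ o m (k + 1) ++ ([o + m + 1] ++ wStr o k (m + 1 - k)) := by
  rw [SStr₀_succ (by omega), wStr_succ, show m + 2 - (k + 1) = m + 1 - k by omega,
    show o + (m + 1 - k) + k = o + m + 1 by omega]
  rfl

theorem SStr₀_pred_append {o m k : ℕ} (h : k ≤ m) :
    SStr₀ o (m - 1) k ++ wStr o k (m + 1 - k) = SStr₀ o m k := by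
  cases m with
  | zero =>
    obtain rfl : k = 0 := by omega
    simp [SStr₀_zero, wStr_zero]
  | succ m => exact (SStr₀_succ h).symm

theorem mem_wStr {o k j c : ℕ} (h : c ∈ wStr o k j) : o + j ≤ c ∧ c + 1 ≤ o + j + k := by
  simp only [wStr, List.mem_map, List.mem_range] at h
  obtain ⟨m, hm, rfl⟩ := h
  omega

theorem mem_SStr₀ {o m k c : ℕ} (h : c ∈ SStr₀ o m k) : o < c ∧ c ≤ o + m := by
  simp only [SStr₀, List.mem_flatMap, List.mem_range] at h
  obtain ⟨j, hj, h⟩ := h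
  have := mem_wStr h
  omega

theorem mem_prinStr {o m c : ℕ} {a : ℕ → ℕ} (h : c ∈ prinStr o m a) : o < c ∧ c ≤ o + m := by
  simp only [prinStr, List.mem_flatMap, List.mem_range, List.mem_flatten, List.mem_replicate] at h
  obtain ⟨k, hk, L, ⟨-, rfl⟩, h⟩ := h
  rw [SStr_eq_SStr₀ (by omega)] at h
  exact mem_SStr₀ h

theorem flatMap_congr_of_mem {α β : Type} {L : List α} {f g : α → List β}
    (h : ∀ x ∈ L, f x = g x) : L.flatMap f = L.flatMap g := by
  rw [List.flatMap_def, List.flatMap_def, List.map_congr_left h]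

theorem prinStr_congr {o m : ℕ} {a a' : ℕ → ℕ} (h : ∀ k, o < k → k ≤ o + m → a k = a' k) :
    prinStr o m a = prinStr o m a' := by
  refine flatMap_congr_of_mem fun k hk => ?_
  rw [List.mem_range] at hk
  rw [h _ (by omega) (by omega)]

theorem prinStr_addUnit {o m k : ℕ} {a : ℕ → ℕ} (h : ∀ j, o + k < j → j ≤ o + m → a j = 0) :
    prinStr o m (addUnit a (o + k)) = prinStr o m a ++ SStr₀ o m k := by
  have key : ∀ r ≤ m, ((List.range r).flatMap fun km =>
      (List.replicate (addUnit a (o + k) (o + km + 1)) (SStr o m (km + 1))).flatten) =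
      ((List.range r).flatMap fun km =>
      (List.replicate (a (o + km + 1)) (SStr o m (km + 1))).flatten) ++
        if 1 ≤ k ∧ k ≤ r then SStr₀ o m k else [] := by
    intro r
    induction r with
    | zero =>
      intro _
      rw [if_neg (by omega)]
      rfl
    | succ r ih =>
      intro hr
      rw [List.range_succ, List.flatMap_append, List.flatMap_append, ih (by omega)]
      simp only [List.flatMap_cons, List.flatMap_nil, List.append_nil, addUnit]
      by_cases hk : k = r + 1
      · subst hk
        rw [if_neg (by omega), if_pos (by omega), if_pos (by omega), List.replicate_succ',
          List.flatten_append, SStr_eq_SStr₀ hr]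
        simp
      · rw [if_neg (by omega : ¬ o + r + 1 = o + k)]
        by_cases hk1 : 1 ≤ k ∧ k ≤ r
        · rw [if_pos hk1, if_pos (by omega), h _ (by omega) (by omega)]
          simp
        · rw [if_neg hk1, if_neg (by omega)]
          simp
  rw [prinStr, key m le_rfl, prinStr]
  congr 1
  by_cases h0 : k = 0
  · simp [h0, SStr₀_zero]
  · by_cases hm : k ≤ m
    · rw [if_pos (by omega)]
    · rw [if_neg (by omega), SStr₀_of_lt (by omega)]

theorem upStr_append_upStr_addUnit {K : PreGraph} {n : ℕ} (hK : IsACrystal n K) {o m c : ℕ}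
    {u : K.V} (hu : IsSourceOn K o (m + 1) u) (hc : o < c) (hcm : c ≤ o + m + 1) (a : ℕ → ℕ) :
    applyStr K (upStr o (m + 1) (headSum o a) ++
      (upStr o m (headSum o (addUnit (fun i => a (i + 1)) c)) ++ [o + m + 1])) u =
    applyStr K (upStr o (m + 1) (headSum o (addUnit a c)) ++
      upStr o m (headSum o (fun i => a (i + 1)))) u := by
  have h1 : headSum o a (o + 1) = a (o + 1) := by
    rw [headSum_succ le_rfl, headSum_self, zero_add]
  have z1 := upStr_append_upStr_eq_zigStr hK hu (A := headSum o a)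
    (P := headSum o (addUnit (fun i => a (i + 1)) c)) (y := fun _ => a (o + 1))
    (w := fun k => headSum o (fun i => a (i + 1)) (k - 1))
    (z := fun k => headSum o (addUnit (fun i => a (i + 1)) c) k + a (o + 1)) h1.symm
    (fun k hk1 hk2 => by
      have e1 := headSum_shift hk1.le a
      have e2 := headSum_addUnit hc hk1.le (fun i => a (i + 1))
      unfold Braid
      simp only [Nat.add_sub_cancel, e2, true_and]
      omega)
  have z2 := upStr_append_upStr_eq_zigStr hK hu (A := headSum o (addUnit a c))
    (P := headSum o (fun i => a (i + 1)))
    (y := fun k => a (o + 1) + if c ≤ k then 1 else 0)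
    (w := fun k => headSum o (fun i => a (i + 1)) (k - 1))
    (z := fun k => headSum o (addUnit (fun i => a (i + 1)) c) k + a (o + 1))
    (by rw [headSum_addUnit hc (by omega), h1])
    (fun k hk1 hk2 => by
      have e1 := headSum_shift hk1.le a
      have e2 := headSum_addUnit hc hk1.le (fun i => a (i + 1))
      have e3 := headSum_addUnit hc (by omega : o ≤ k + 1) a
      unfold Braid
      simp only [Nat.add_sub_cancel, e2, e3]
      split_ifs <;> omega)
  rw [z2, ← List.append_assoc, applyStr_congr_left _ z1, if_pos hcm, List.replicate_succ',
    List.append_assoc]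

theorem exists_addUnit_or_eq_zero (o m : ℕ) (a : ℕ → ℕ) :
    (∀ j, o < j → j ≤ o + m → a j = 0) ∨ ∃ k < m, ∃ b, a = addUnit b (o + (k + 1)) ∧
      ∀ j, o + (k + 1) < j → j ≤ o + m → b j = 0 := by
  induction m with
  | zero =>
    left
    intro j h1 h2
    omega
  | succ m ih =>
    by_cases h : a (o + m + 1) = 0
    · rcases ih with h0 | ⟨k, hk, b, rfl, hb⟩
      · left
        intro j h1 h2
        by_cases hj : j = o + m + 1
        · rwa [hj]
        · exact h0 j h1 (by omega)
      · refine Or.inr ⟨k, by omega, b, rfl, fun j h1 h2 => ?_⟩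
        by_cases hj : j = o + m + 1
        · rw [hj]
          simp only [addUnit] at h
          omega
        · exact hb j h1 (by omega)
    · refine Or.inr ⟨m, by omega, fun i => a i - if i = o + (m + 1) then 1 else 0, ?_,
        fun j h1 h2 => by omega⟩
      funext i
      simp only [addUnit]
      by_cases hi : i = o + (m + 1)
      · subst hi
        simp only [if_true, ← add_assoc]
        omega
      · simp [hi]

theorem monotone_headSum {o k : ℕ} (h : o ≤ k) (a : ℕ → ℕ) :
    headSum o a k ≤ headSum o a (k + 1) := by
  rw [headSum_succ h]
  omega

theorem antitone_tailSum (e k : ℕ) (a : ℕ → ℕ) : tailSum e a (k + 1) ≤ tailSum e a k := by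
  by_cases h : k ≤ e
  · rw [tailSum_eq h]
    omega
  · rw [tailSum_of_lt (by omega)]
    omega

theorem prinStr_eq_upStr_zero {o m : ℕ} {a : ℕ → ℕ} (h : ∀ j, o < j → j ≤ o + m → a j = 0) :
    prinStr o m a = [] ∧ upStr o m (headSum o a) = [] ∧
      prinStr o (m - 1) (fun i => a (i + 1)) = [] := by
  have nil : ∀ m, prinStr o m (fun _ => 0) = [] := fun m => by simp [prinStr]
  refine ⟨?_, ?_, ?_⟩
  · rw [prinStr_congr h, nil]
  · induction m with
    | zero => rfl
    | succ m ih =>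
      rw [upStr, ih fun j h1 h2 => h j h1 (by omega), headSum, Finset.sum_eq_zero fun j hj => ?_]
      · rfl
      · rw [Finset.mem_Ioc] at hj
        exact h j hj.1 hj.2
  · rw [prinStr_congr (a' := fun _ => 0) fun j h1 h2 => h (j + 1) (by omega) (by omega), nil]

/-- The path to a principal vertex may start with an increasing word, which ends at the source
of an upper subcrystal. -/
theorem prinStr_eq_upStr {K : PreGraph} {n : ℕ} (hK : IsACrystal n K) {o m : ℕ} {u : K.V}
    (hu : IsSourceOn K o m u) (a : ℕ → ℕ) :
    applyStr K (prinStr o m a) u =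
      applyStr K (upStr o m (headSum o a) ++ prinStr o (m - 1) (fun i => a (i + 1))) u := by
  induction m generalizing u a with
  | zero => rfl
  | succ m ih =>
    induction hd : headSum o a (o + (m + 1)) generalizing a with
    | zero =>
      obtain ⟨h1, h2, h3⟩ := prinStr_eq_upStr_zero (o := o) (m := m + 1) (a := a) fun j h1 h2 => by
        rw [headSum, Finset.sum_eq_zero_iff] at hd
        exact hd j (Finset.mem_Ioc.2 ⟨h1, h2⟩)
      rw [h1, h2, h3]
      rfl
    | succ d ihd =>
      rcases exists_addUnit_or_eq_zero o (m + 1) a with h0 | ⟨k, hk, b, rfl, hb⟩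
      · obtain ⟨h1, h2, h3⟩ := prinStr_eq_upStr_zero h0
        rw [h1, h2, h3]
        rfl
      have s1 := ihd b (by
        rw [headSum_addUnit (by omega) (by omega), if_pos (by omega)] at hd
        omega)
      have src : ∀ {e x}, applyStr K (upStr o (m + 1) (headSum o e)) u = some x →
          IsSourceOn K o m x := fun h =>
        hu.upStr hK (fun k h1 h2 => monotone_headSum h1.le _) h
      have f1 : prinStr o (m + 1) (addUnit b (o + (k + 1))) =
          prinStr o (m + 1) b ++ (SStr₀ o m (k + 1) ++ ([o + m + 1] ++ wStr o k (m + 1 - k))) := by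
        rw [prinStr_addUnit hb, SStr₀_succ_succ (by omega)]
      have f2 : prinStr o m (fun i => b (i + 1)) ++ SStr₀ o m (k + 1) =
          prinStr o m (addUnit (fun i => b (i + 1)) (o + (k + 1))) :=
        (prinStr_addUnit fun j h1 h2 => hb _ (by omega) (by omega)).symm
      have f3 : prinStr o (m - 1)
          (fun i => addUnit (fun i => b (i + 1)) (o + (k + 1)) (i + 1)) =
          prinStr o (m - 1) (fun i => b (i + 1 + 1)) ++ SStr₀ o (m - 1) k := by
        rw [← prinStr_addUnit fun j h1 h2 => hb _ (by omega) (by omega)]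
        refine prinStr_congr fun j _ _ => ?_
        simp only [addUnit, ← add_assoc, Nat.add_right_cancel_iff]
      have f4 : prinStr o m (fun i => b (i + 1)) ++ SStr₀ o m k =
          prinStr o m (fun i => addUnit b (o + (k + 1)) (i + 1)) := by
        rw [← prinStr_addUnit fun j h1 h2 => hb _ (by omega) (by omega)]
        refine prinStr_congr fun j _ _ => ?_
        simp only [addUnit, ← add_assoc, Nat.add_right_cancel_iff]
      set U := upStr o (m + 1) (headSum o b)
      set U' := upStr o (m + 1) (headSum o (addUnit b (o + (k + 1)))) with hU'
      set T := upStr o m (headSum o (addUnit (fun i => b (i + 1)) (o + (k + 1))))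
      set T' := upStr o m (headSum o (fun i => b (i + 1)))
      set W := wStr o k (m + 1 - k) with hW
      set R := prinStr o (m - 1) (fun i => b (i + 1 + 1)) ++ SStr₀ o (m - 1) k with hR
      have s2 : applyStr K (U ++ prinStr o m (addUnit (fun i => b (i + 1)) (o + (k + 1)))) u =
          applyStr K (U ++ (T ++ R)) u := applyStr_congr_right U fun x hx => by
        rw [ih (src hx), f3]
      have s3 : applyStr K (U ++ T ++ (R ++ [o + m + 1])) u =
          applyStr K (U ++ T ++ ([o + m + 1] ++ R)) u :=
        applyStr_congr_right _ fun x _ => applyStr_append_comm hK (fun i hi j hj => by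
          rw [List.mem_singleton] at hj
          rcases List.mem_append.1 hi with hi | hi
          · have := mem_prinStr hi
            left
            omega
          · have := mem_SStr₀ hi
            left
            omega) x
      have s4 : applyStr K (U ++ (T ++ [o + m + 1])) u = applyStr K (U' ++ T') u :=
        upStr_append_upStr_addUnit hK hu (by omega) (by omega) b
      have s5 : applyStr K (U' ++ (T' ++ prinStr o (m - 1) (fun i => b (i + 1 + 1)))) u =
          applyStr K (U' ++ prinStr o m (fun i => b (i + 1))) u :=
        applyStr_congr_right U' fun x hx => (ih (src hx) (fun i => b (i + 1))).symm
      calc applyStr K (prinStr o (m + 1) (addUnit b (o + (k + 1)))) u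
          = applyStr K (U ++ prinStr o m (addUnit (fun i => b (i + 1)) (o + (k + 1))) ++
              ([o + m + 1] ++ W)) u := by
            rw [f1, applyStr_congr_left _ s1, ← f2]
            simp
        _ = applyStr K (U ++ T ++ (R ++ [o + m + 1]) ++ W) u := by
            rw [applyStr_congr_left _ s2]
            simp only [List.append_assoc]
        _ = applyStr K (U ++ (T ++ [o + m + 1]) ++ (R ++ W)) u := by
            rw [applyStr_congr_left _ s3]
            simp only [List.append_assoc]
        _ = applyStr K (U' ++ (T' ++ prinStr o (m - 1) (fun i => b (i + 1 + 1))) ++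
              SStr₀ o m k) u := by
            rw [applyStr_congr_left _ s4, hR, List.append_assoc (prinStr _ _ _), hW,
              SStr₀_pred_append (by omega)]
            simp only [List.append_assoc]
        _ = applyStr K (U' ++ prinStr o m (fun i => addUnit b (o + (k + 1)) (i + 1))) u := by
            rw [applyStr_congr_left _ s5, ← f4, List.append_assoc]

/-- The path to a principal vertex may start with a decreasing word, which ends at the source
of a lower subcrystal. -/
theorem prinStr_eq_downStr {K : PreGraph} {n : ℕ} (hK : IsACrystal n K) {o m : ℕ} {u : K.V}
    (hu : IsSourceOn K o m u) (a : ℕ → ℕ) :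
    applyStr K (prinStr o m a) u =
      applyStr K (downStr o m (tailSum (o + m) a) ++
        prinStr (o + 1) (m - 1) (fun i => a (i - 1))) u := by
  induction m generalizing u a with
  | zero => rfl
  | succ m ih =>
    set P := tailSum (o + m) (fun i => a (i + 1))
    have s1 := prinStr_eq_upStr hK hu a
    have s2 : applyStr K (upStr o (m + 1) (headSum o a) ++ prinStr o m (fun i => a (i + 1))) u =
        applyStr K (upStr o (m + 1) (headSum o a) ++ (downStr o m P ++
          prinStr (o + 1) (m - 1) a)) u := applyStr_congr_right _ fun x hx => by
      rw [ih (hu.upStr hK (fun k h1 h2 => monotone_headSum h1.le _) hx),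
        prinStr_congr (a' := a) fun k h1 h2 => by
          rw [Nat.sub_add_cancel (by omega)]]
    have s3 := mountain_eq_valley hK hu (A := headSum o a)
      (M := fun _ => headSum o a (o + (m + 1))) (P := P) (B := tailSum (o + (m + 1)) a)
      (Q := headSum (o + 1) (fun i => a (i - 1)))
      (by
        have := headSum_add_tailSum (m := m + 1) a (le_refl o) (by omega)
        rwa [headSum_self, zero_add] at this)
      (fun k h1 h2 => by
        have e1 := headSum_add_tailSum (m := m + 1) a h1.le (by omega)
        have e2 : P k = tailSum (o + (m + 1)) a (k + 1) := tailSum_shift (by omega) a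
        rw [headSum_pred h1.le a, e2]
        unfold Braid
        omega)
    have s4 : applyStr K (downStr o (m + 1) (tailSum (o + (m + 1)) a) ++
        prinStr (o + 1) m (fun i => a (i - 1))) u =
        applyStr K (downStr o (m + 1) (tailSum (o + (m + 1)) a) ++
        (upStr (o + 1) m (headSum (o + 1) (fun i => a (i - 1))) ++
          prinStr (o + 1) (m - 1) a)) u := applyStr_congr_right _ fun x hx => by
      rw [prinStr_eq_upStr hK (hu.downStr hK (fun k _ _ => antitone_tailSum _ k a) hx)]
      simp
    have s5 := applyStr_congr_left (prinStr (o + 1) (m - 1) a) s3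
    simp only [List.append_assoc] at s5
    rw [s1, Nat.add_sub_cancel, s2, s4, ← s5, upStr]
    simp only [List.append_assoc]
    rfl

/-! ### Uniqueness of exponents -/

theorem upStr_unique {K : PreGraph} {n : ℕ} (hK : IsACrystal n K) {o m : ℕ} {x x' v : K.V}
    (hx : IsSourceOn K o m x) (hx' : IsSourceOn K o m x') {Q Q' : ℕ → ℕ}
    (h : applyStr K (upStr o m Q) x = some v) (h' : applyStr K (upStr o m Q') x' = some v) :
    x = x' ∧ ∀ k, o < k → k ≤ o + m → Q k = Q' k := by
  induction m generalizing v with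
  | zero =>
    cases h
    cases h'
    exact ⟨rfl, fun k h1 h2 => by omega⟩
  | succ m ih =>
    rw [upStr, applyStr_append_eq_some] at h h'
    obtain ⟨y, hy, hyv⟩ := h
    obtain ⟨y', hy', hyv'⟩ := h'
    have t1 := t_applyStr_replicate hK.1 hyv
    have t2 := t_applyStr_replicate hK.1 hyv'
    rw [t_eq_zero_applyStr hK hy (fun hm => by have := mem_upStr hm; omega)
      (hx _ (by omega) (by omega))] at t1
    rw [t_eq_zero_applyStr hK hy' (fun hm => by have := mem_upStr hm; omega)
      (hx' _ (by omega) (by omega))] at t2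
    have hQ : Q (o + m + 1) = Q' (o + m + 1) := by omega
    rw [← hQ] at hyv'
    obtain rfl := applyStr_replicate_inj hK.1 hyv hyv'
    obtain ⟨h1, h2⟩ := ih (hx.mono le_rfl (by omega)) (hx'.mono le_rfl (by omega)) hy hy'
    refine ⟨h1, fun k hk hk' => ?_⟩
    by_cases hkm : k = o + m + 1
    · rw [hkm, hQ]
    · exact h2 k hk (by omega)

theorem downStr_unique {K : PreGraph} {n : ℕ} (hK : IsACrystal n K) {o m : ℕ} {x x' v : K.V}
    (hx : IsSourceOn K o m x) (hx' : IsSourceOn K o m x') {B B' : ℕ → ℕ}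
    (h : applyStr K (downStr o m B) x = some v) (h' : applyStr K (downStr o m B') x' = some v) :
    x = x' ∧ ∀ k, o < k → k ≤ o + m → B k = B' k := by
  induction m generalizing v o with
  | zero =>
    cases h
    cases h'
    exact ⟨rfl, fun k h1 h2 => by omega⟩
  | succ m ih =>
    rw [downStr_succ_append, applyStr_append_eq_some] at h h'
    obtain ⟨y, hy, hyv⟩ := h
    obtain ⟨y', hy', hyv'⟩ := h'
    have t1 := t_applyStr_replicate hK.1 hyv
    have t2 := t_applyStr_replicate hK.1 hyv'
    rw [t_eq_zero_applyStr hK hy (fun hm => by have := mem_downStr hm; omega)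
      (hx _ (by omega) (by omega))] at t1
    rw [t_eq_zero_applyStr hK hy' (fun hm => by have := mem_downStr hm; omega)
      (hx' _ (by omega) (by omega))] at t2
    have hB : B (o + 1) = B' (o + 1) := by omega
    rw [← hB] at hyv'
    obtain rfl := applyStr_replicate_inj hK.1 hyv hyv'
    obtain ⟨h1, h2⟩ := ih (hx.mono (by omega) (by omega)) (hx'.mono (by omega) (by omega)) hy hy'
    refine ⟨h1, fun k hk hk' => ?_⟩
    by_cases hkm : k = o + 1
    · rw [hkm, hB]
    · exact h2 k (by omega) (by omega)

/-! ### Subcrystals -/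

theorem pbind_mk_eq_some_iff {α : Type*} {q : α → Prop} (o : Option α) (f : ∀ w ∈ o, q w)
    (y : {u // q u}) :
    (o.pbind fun w hw => some (⟨w, f w hw⟩ : {u // q u})) = some y ↔ o = some y.1 := by
  cases o with
  | none => simp
  | some w => simp [Subtype.ext_iff]

theorem sub_F_eq_some {K : PreGraph} {I : Set ℕ} {v : K.V} {i : ℕ} {x y : (K.sub I v).V} :
    (K.sub I v).F i x = some y ↔ i ∈ I ∧ K.F i x.1 = some y.1 := by
  by_cases hi : i ∈ I
  · have hF : (K.sub I v).F i x = (K.F i x.1).pbind fun w hw =>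
        some ⟨w, x.2.tail ⟨i, hi, Or.inl (Option.mem_def.mp hw)⟩⟩ := dif_pos hi
    have hy := pbind_mk_eq_some_iff (q := inComp K I v) (K.F i x.1)
      (fun w hw => x.2.tail ⟨i, hi, Or.inl (Option.mem_def.mp hw)⟩) y
    exact ⟨fun h => ⟨hi, hy.1 (hF.symm.trans h)⟩, fun h => hF.trans (hy.2 h.2)⟩
  · simp [PreGraph.sub, hi]

theorem applyStr_of_sub {K : PreGraph} {I : Set ℕ} {v : K.V} {L : List ℕ} {x y : (K.sub I v).V}
    (h : applyStr (K.sub I v) L x = some y) : applyStr K L x.1 = some y.1 := by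
  induction L generalizing x with
  | nil =>
    cases h
    rfl
  | cons i L ih =>
    obtain ⟨w, hw, hwy⟩ := Option.bind_eq_some_iff.1 h
    exact Option.bind_eq_some_iff.2 ⟨w.1, (sub_F_eq_some.1 hw).2, ih hwy⟩

theorem t_eq_zero_of_isSource_sub {K : PreGraph} {C : Set ℕ} (hK : IsColored K C) {I : Set ℕ}
    {v : K.V} {x : (K.sub I v).V} (hx : IsSource (K.sub I v) x) :
    ∀ i ∈ I, K.t i x.1 = 0 := by
  intro i hi
  by_contra h
  obtain ⟨p, hp⟩ := (t_pos_iff hK).1 (Nat.pos_of_ne_zero h)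
  exact hx i ⟨p, inComp.parent x.2 hi hp⟩ (sub_F_eq_some.2 ⟨hi, hp⟩)

theorem IsSourceOn.eq_of_inComp {K : PreGraph} {n : ℕ} (hK : IsACrystal n K) {o m : ℕ}
    {I : Set ℕ} (hI : I = Set.Icc (o + 1) (o + m)) {u v : K.V} (hu : IsSourceOn K o m u)
    (hv : ∀ i ∈ I, K.t i v = 0) (h : inComp K I u v) : u = v := by
  subst hI
  exact source_eq_of_inComp hK (fun i hi => hu i hi.1 hi.2) hv h

theorem inComp_of_prinStr {K : PreGraph} {o m : ℕ} {I : Set ℕ} (hI : I = Set.Icc (o + 1) (o + m))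
    {a : ℕ → ℕ} {u v : K.V} (h : applyStr K (prinStr o m a) u = some v) : inComp K I u v := by
  subst hI
  exact inComp_of_applyStr (fun k hk => mem_prinStr hk) h

/-- main structure theorem for `A_n`-crystals. With `D_0 = D_n = 0`, if the
middle subcrystal containing `v^up[a|D]` lies in the lower subcrystal `K^low[b]` and meets
its principal lattice in `v^low[b|N]`, then `b_i = a_i + D_i^+ + D_{i-1}^-` for
`i = 1, …, n` and `N_i = -D_{i-1}` for `i = 2, …, n`. -/
theorem middle_subcrystal_locus
    (n : ℕ) (hn : 2 ≤ n) (K : PreGraph) (hK : IsACrystal n K)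
    (s : K.V) (hs : IsSource K s)
    (c : ℕ → ℕ) (hc : ∀ i, 1 ≤ i → i ≤ n → K.h i s = c i)
    (a : ℕ → ℕ) (ha : ∀ i, 1 ≤ i → i ≤ n → a i ≤ c i)
    (pa : K.V) (hpa : IsPrin K 0 n s a pa)
    (D : ℕ → ℤ) (hD0 : D 0 = 0) (hDn : D n = 0)
    (hDlow : ∀ i, 1 ≤ i → i ≤ n - 1 → 0 ≤ (a (i + 1) : ℤ) + D i)
    (hDup : ∀ i, 1 ≤ i → i ≤ n - 1 →
      (a (i + 1) : ℤ) + D i ≤ (c i : ℤ) - (a i : ℤ) + (a (i + 1) : ℤ))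
    (s' : (K.sub (Set.Icc 1 (n - 1)) pa).V)
    (hs' : IsSource (K.sub (Set.Icc 1 (n - 1)) pa) s')
    (z : (K.sub (Set.Icc 1 (n - 1)) pa).V)
    (hz : IsPrin (K.sub (Set.Icc 1 (n - 1)) pa) 0 (n - 1) s'
      (fun i => ((a (i + 1) : ℤ) + D i).toNat) z)
    (b : ℕ → ℕ) (hb : ∀ i, 1 ≤ i → i ≤ n → b i ≤ c i)
    (pb : K.V) (hpb : IsPrin K 0 n s b pb)
    (hzb : inComp K (Set.Icc 2 n) pb z.1)
    (s'' : (K.sub (Set.Icc 2 n) pb).V)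
    (hs'' : IsSource (K.sub (Set.Icc 2 n) pb) s'')
    (N : ℕ → ℤ) (hN : ∀ i, 2 ≤ i → i ≤ n → 0 ≤ (b (i - 1) : ℤ) + N i)
    (z' : (K.sub (Set.Icc 2 n) pb).V)
    (hz' : IsPrin (K.sub (Set.Icc 2 n) pb) 1 (n - 1) s''
      (fun i => ((b (i - 1) : ℤ) + N i).toNat) z')
    (hmid : inComp K (Set.Icc 2 (n - 1)) z.1 z'.1) :
    (∀ i, 1 ≤ i → i ≤ n →
      (b i : ℤ) = (a i : ℤ) + max (D i) 0 + min (D (i - 1)) 0) ∧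
    (∀ i, 2 ≤ i → i ≤ n → N i = - D (i - 1)) := by
  obtain ⟨r, rfl⟩ : ∃ r, n = r + 2 := ⟨n - 2, by omega⟩
  simp only [show r + 2 - 1 = r + 1 from rfl] at *
  have hsrc : IsSourceOn K 0 (r + 2) s := by
    intro k _ _
    by_contra h
    obtain ⟨p, hp⟩ := (t_pos_iff hK.1).1 (Nat.pos_of_ne_zero h)
    exact hs k p hp
  have I1 : Set.Icc 1 (r + 1) = Set.Icc (0 + 1) (0 + (r + 1)) := by simp
  have I2 : Set.Icc 2 (r + 2) = Set.Icc (1 + 1) (1 + (r + 1)) := by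
    rw [show 1 + (r + 1) = r + 2 by omega]
  have I3 : Set.Icc 2 (r + 1) = Set.Icc (1 + 1) (1 + r) := by
    rw [show 1 + r = r + 1 by omega]
  -- the source of the upper subcrystal
  have hpa' : applyStr K (prinStr 0 (r + 2) a) s = some pa := hpa
  rw [prinStr_eq_upStr hK hsrc, applyStr_append_eq_some] at hpa'
  obtain ⟨u, hu, hupa⟩ := hpa'
  have usrc : IsSourceOn K 0 (r + 1) u :=
    hsrc.upStr hK (fun k h1 _ => monotone_headSum h1.le a) hu
  have hus : u = s'.1 := usrc.eq_of_inComp hK I1 (t_eq_zero_of_isSource_sub hK.1 hs')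
    ((inComp_of_prinStr I1 hupa).trans s'.2)
  -- the source of the middle subcrystal, seen from above
  set p : ℕ → ℕ := fun i => ((a (i + 1) : ℤ) + D i).toNat with hp
  have hz1 := applyStr_of_sub hz
  rw [← hus, prinStr_eq_downStr hK usrc, applyStr_append_eq_some] at hz1
  obtain ⟨x, hx, hxz⟩ := hz1
  have xsrc : IsSourceOn K 1 r x := usrc.downStr hK (fun k _ _ => antitone_tailSum _ k p) hx
  -- the source of the lower subcrystal
  have hpb' : applyStr K (prinStr 0 (r + 2) b) s = some pb := hpb
  rw [prinStr_eq_downStr hK hsrc, applyStr_append_eq_some] at hpb'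
  obtain ⟨w, hw, hwpb⟩ := hpb'
  have wsrc : IsSourceOn K 1 (r + 1) w :=
    hsrc.downStr hK (fun k _ _ => antitone_tailSum _ k b) hw
  have hws : w = s''.1 := wsrc.eq_of_inComp hK I2 (t_eq_zero_of_isSource_sub hK.1 hs'')
    ((inComp_of_prinStr I2 hwpb).trans s''.2)
  -- the source of the middle subcrystal, seen from below
  set q : ℕ → ℕ := fun i => ((b (i - 1) : ℤ) + N i).toNat with hq
  have hz2 := applyStr_of_sub hz'
  rw [← hws, prinStr_eq_upStr hK wsrc, applyStr_append_eq_some] at hz2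
  obtain ⟨y, hy, hyz⟩ := hz2
  have ysrc : IsSourceOn K 1 r y := wsrc.upStr hK (fun k h1 _ => monotone_headSum h1.le q) hy
  have hxy : x = y := by
    refine xsrc.eq_of_inComp hK I3 (fun i hi => ysrc i hi.1 (by have := hi.2; omega)) ?_
    exact ((inComp_of_prinStr I3 hxz).trans hmid).trans (inComp_of_prinStr I3 hyz).symm
  subst hxy
  -- comparison of the two paths to this vertex
  set A := headSum 0 a with hA
  set P := tailSum (0 + (r + 1)) p with hP
  set B := tailSum (0 + (r + 2)) b with hB
  set Q := headSum 1 q with hQ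
  have A0 : A 0 = 0 := headSum_self 0 a
  have As : ∀ k, A (k + 1) = A k + a (k + 1) := fun k => headSum_succ (Nat.zero_le k) a
  have Pe : P (r + 2) = 0 := tailSum_of_lt (by omega) p
  have Ps : ∀ k ≤ r + 1, P k = p k + P (k + 1) := fun k hk => tailSum_eq (by omega) p
  have Be : B (r + 2 + 1) = 0 := tailSum_of_lt (by omega) b
  have Bs : ∀ k ≤ r + 2, B k = b k + B (k + 1) := fun k hk => tailSum_eq (by omega) b
  have Q1 : Q 1 = 0 := headSum_self 1 q
  have Qs : ∀ k, 1 ≤ k → Q (k + 1) = Q k + q (k + 1) := fun k hk => headSum_succ hk q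
  have pD : ∀ k, 1 ≤ k → k ≤ r + 1 → (p k : ℤ) = a (k + 1) + D k :=
    fun k h1 h2 => Int.toNat_of_nonneg (hDlow k h1 h2)
  have qN : ∀ k, 2 ≤ k → k ≤ r + 2 → (q k : ℤ) = b (k - 1) + N k :=
    fun k h1 h2 => Int.toNat_of_nonneg (hN k h1 h2)
  set B' : ℕ → ℕ := fun k => P k + if k = 1 then a 1 else min (p (k - 1)) (a k) with hB'
  have B'1 : B' 1 = P 1 + a 1 := by simp [hB']
  have B's : ∀ k, 1 ≤ k → B' (k + 1) = P (k + 1) + min (p k) (a (k + 1)) := fun k hk => by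
    simp [hB', show k ≠ 0 by omega]
  have mv := mountain_eq_valley hK hsrc (A := A) (M := fun k => A k + P k) (P := P) (B := B')
    (Q := fun k => A k + P k - B' k) (by rw [zero_add, B'1, ← zero_add 1, As, A0]; ring)
    (fun k h1 h2 => by
      have := As k
      have := Ps k (by omega)
      have := B's k h1
      unfold Braid
      omega)
  have hsx : applyStr K (upStr 0 (r + 1) A ++
      (List.replicate (A (0 + (r + 1) + 1) + P (0 + (r + 1) + 1)) (0 + (r + 1) + 1) ++
        downStr 0 (r + 1) P)) s = some x := by
    rw [show P (0 + (r + 1) + 1) = 0 by rw [← Pe]; congr 1; omega, add_zero,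
      ← List.append_assoc, applyStr_append_eq_some]
    exact ⟨u, hu, hx⟩
  rw [mv, applyStr_append_eq_some] at hsx
  obtain ⟨w', hw', hwx'⟩ := hsx
  have wsrc' : IsSourceOn K 1 (r + 1) w' := hsrc.downStr hK (fun k h1 h2 => by
    have h3 := B's k h1
    have h4 := Ps k (by omega)
    have h5 : P k ≤ B' k := Nat.le_add_right _ _
    omega) hw'
  obtain ⟨hww, hQQ⟩ := upStr_unique hK wsrc wsrc' hy hwx'
  subst hww
  obtain ⟨-, hBB⟩ := downStr_unique hK hsrc hsrc hw hw'
  have hBD : ∀ k, 1 ≤ k → k ≤ r + 2 → (B k : ℤ) = a k + P k + min (D (k - 1)) 0 := by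
    intro k h1 h2
    rw [hBB k h1 (by omega)]
    obtain ⟨k, rfl⟩ : ∃ j, k = j + 1 := ⟨k - 1, by omega⟩
    rcases Nat.eq_zero_or_pos k with rfl | hk
    · rw [zero_add, B'1, Nat.sub_self, hD0]
      push_cast
      omega
    · rw [B's k hk, Nat.add_sub_cancel]
      have := pD k hk (by omega)
      push_cast
      omega
  have hQD : ∀ k, k ≤ r + 1 → (Q (k + 1) : ℤ) = A k - min (D k) 0 := by
    intro k hk
    rcases Nat.eq_zero_or_pos k with rfl | hk0
    · rw [zero_add, Q1, A0, hD0]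
      simp
    · have h1 := hQQ (k + 1) (by omega) (by omega)
      have h2 := hBD (k + 1) (by omega) (by omega)
      have h3 := hBB (k + 1) (by omega) (by omega)
      have h4 := As k
      have h5 := B's k hk0
      rw [Nat.add_sub_cancel] at h2
      omega
  have main : ∀ i, 1 ≤ i → i ≤ r + 2 →
      (b i : ℤ) = (a i : ℤ) + max (D i) 0 + min (D (i - 1)) 0 := by
    intro i h1 h2
    have e1 := hBD i h1 h2
    have e2 := Bs i h2
    rcases Nat.lt_or_ge i (r + 2) with hi | hi
    · have e3 := hBD (i + 1) (by omega) (by omega)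
      have e4 := Ps i (by omega)
      have e5 := pD i h1 (by omega)
      rw [Nat.add_sub_cancel] at e3
      omega
    · obtain rfl : i = r + 2 := by omega
      rw [hDn]
      omega
  refine ⟨main, fun i h1 h2 => ?_⟩
  obtain ⟨k, rfl⟩ : ∃ j, i = j + 2 := ⟨i - 2, by omega⟩
  have e1 : (Q (k + 2) : ℤ) = A (k + 1) - min (D (k + 1)) 0 := hQD (k + 1) (by omega)
  have e2 := hQD k (by omega)
  have e3 : Q (k + 2) = Q (k + 1) + q (k + 2) := Qs (k + 1) (by omega)
  have e4 := qN (k + 2) (by omega) h2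
  have e5 := main (k + 1) (by omega) (by omega)
  have e6 := As k
  simp only [Nat.add_sub_cancel, show k + 2 - 1 = k + 1 from rfl] at e4 e5 ⊢
  omega
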